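/- arXiv:1106.4251 — 2 statements merged into one kernel-verified Lean document; each statement's English description precedes it below -/
import Mathlib

section
/- Suppose the sampling distribution p on [n]×[m] has uniform row- and column-marginals, i.e. p^r(i) = 1/n for all i and p^c(j) = 1/m for all j. Let X̂_S = argmin{L̂_S(X) : X ∈ W_p} be an empirical risk minimizer over the p-weighted trace-norm ball. Then there is an absolute constant C such that, in expectation over a training sample S of size s drawn i.i.d. from p, E_S[L_p(X̂_S)] ≤ inf_{X ∈ W_p} L_p(X) + C · l · √(r·n·log(n)/s). -/
open scoped Classical
open Matrix Finset

noncomputable section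

/-- Trace norm (sum of singular values) of a real matrix. -/
def traceNorm {n m : ℕ} (X : Matrix (Fin n) (Fin m) ℝ) : ℝ :=
  ∑ j, Real.sqrt ((Matrix.isHermitian_conjTranspose_mul_self X).eigenvalues j)

/-- Weighted trace norm with row weights `pr` and column weights `pc`. -/
def wTrNorm {n m : ℕ} (pr : Fin n → ℝ) (pc : Fin m → ℝ)
    (X : Matrix (Fin n) (Fin m) ℝ) : ℝ :=
  traceNorm (Matrix.diagonal (fun i => Real.sqrt (pr i)) * X *
    Matrix.diagonal (fun j => Real.sqrt (pc j)))

/-- Weighted trace-norm ball of radius `√r`. -/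
def Wball {n m : ℕ} (pr : Fin n → ℝ) (pc : Fin m → ℝ) (r : ℝ) :
    Set (Matrix (Fin n) (Fin m) ℝ) :=
  {X | wTrNorm pr pc X ≤ Real.sqrt r}

/-- Row marginals of a distribution on `[n] × [m]`. -/
def rowMarg {n m : ℕ} (p : Matrix (Fin n) (Fin m) ℝ) (i : Fin n) : ℝ := ∑ j, p i j

/-- Column marginals of a distribution on `[n] × [m]`. -/
def colMarg {n m : ℕ} (p : Matrix (Fin n) (Fin m) ℝ) (j : Fin m) : ℝ := ∑ i, p i j

/-- `p` is a probability distribution on `[n] × [m]`. -/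
def IsDistrib {n m : ℕ} (p : Matrix (Fin n) (Fin m) ℝ) : Prop :=
  (∀ i j, 0 ≤ p i j) ∧ ∑ i, ∑ j, p i j = 1

/-- `ℓ` is `l`-Lipschitz in its first argument. -/
def LipLoss (l : ℝ) (ℓ : ℝ → ℝ → ℝ) : Prop :=
  ∀ x x' y, |ℓ x y - ℓ x' y| ≤ l * |x - x'|

/-- Probability of drawing the i.i.d. sample `S` from `p`. -/
def sampleProb {n m s : ℕ} (p : Matrix (Fin n) (Fin m) ℝ)
    (S : Fin s → Fin n × Fin m) : ℝ :=
  ∏ t, p (S t).1 (S t).2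

/-- Expectation over an i.i.d. sample of size `s` drawn from `p`. -/
def Esample {n m : ℕ} (s : ℕ) (p : Matrix (Fin n) (Fin m) ℝ)
    (f : (Fin s → Fin n × Fin m) → ℝ) : ℝ :=
  ∑ S : Fin s → Fin n × Fin m, sampleProb p S * f S

/-- Empirical risk of `X` on the sample `S` (target matrix `Y`, loss `ℓ`). -/
def empRisk {n m s : ℕ} (ℓ : ℝ → ℝ → ℝ) (Y : Matrix (Fin n) (Fin m) ℝ)
    (S : Fin s → Fin n × Fin m) (X : Matrix (Fin n) (Fin m) ℝ) : ℝ :=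
  (1 / (s : ℝ)) * ∑ t, ℓ (X (S t).1 (S t).2) (Y (S t).1 (S t).2)

/-- Population risk of `X` under sampling distribution `p`. -/
def popRisk {n m : ℕ} (p : Matrix (Fin n) (Fin m) ℝ) (ℓ : ℝ → ℝ → ℝ)
    (Y X : Matrix (Fin n) (Fin m) ℝ) : ℝ :=
  ∑ i, ∑ j, p i j * ℓ (X i j) (Y i j)

def sgn (b : Bool) : ℝ := if b then 1 else -1

lemma sgn_not (b : Bool) : sgn (!b) = - sgn b := by cases b <;> simp [sgn]
lemma sgn_sq (b : Bool) : sgn b * sgn b = 1 := by cases b <;> simp [sgn]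

lemma le_fsup {K : Type*} [Fintype K] (f : K → ℝ) (k : K) : f k ≤ ⨆ k, f k :=
  le_ciSup (Set.finite_range f).bddAbove k

lemma exists_fsup {K : Type*} [Fintype K] [Nonempty K] (f : K → ℝ) : ∃ k, ⨆ k, f k = f k := by
  obtain ⟨k, hk⟩ := exists_eq_ciSup_of_finite (f := f)
  exact ⟨k, hk.symm⟩

lemma contr_pair {K : Type*} [Fintype K] [Nonempty K] (g a b : K → ℝ)
    (h : ∀ k k', |a k - a k'| ≤ |b k - b k'|) :
    (⨆ k, (g k + a k)) + (⨆ k, (g k - a k)) ≤ (⨆ k, (g k + b k)) + (⨆ k, (g k - b k)) := by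
  obtain ⟨k, hk⟩ := exists_fsup (fun k => g k + a k)
  obtain ⟨k', hk'⟩ := exists_fsup (fun k => g k - a k)
  rw [hk, hk']
  have h1 := le_fsup (fun k => g k + b k) k
  have h2 := le_fsup (fun k => g k + b k) k'
  have h3 := le_fsup (fun k => g k - b k) k
  have h4 := le_fsup (fun k => g k - b k) k'
  have h5 := h k k'
  have h6 := le_abs_self (a k - a k')
  rcases abs_cases (b k - b k') with ⟨h7, _⟩ | ⟨h7, _⟩ <;> linarith

lemma contraction {K : Type*} [Fintype K] [Nonempty K] (s : ℕ) : ∀ (g : K → ℝ) (a b : Fin s → K → ℝ),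
    (∀ t k k', |a t k - a t k'| ≤ |b t k - b t k'|) →
    ∑ e : Fin s → Bool, (⨆ k, (g k + ∑ t, sgn (e t) * a t k)) ≤
    ∑ e : Fin s → Bool, (⨆ k, (g k + ∑ t, sgn (e t) * b t k)) := by
  induction s with
  | zero => intro g a b h; simp
  | succ s ih =>
    intro g a b h
    have key : ∀ c : Fin (s+1) → K → ℝ,
      ∑ e : Fin (s+1) → Bool, (⨆ k, (g k + ∑ t, sgn (e t) * c t k)) =
      ∑ b0 : Bool, ∑ e : Fin s → Bool, (⨆ k, ((g k + sgn b0 * c 0 k) + ∑ t : Fin s, sgn (e t) * c t.succ k)) := by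
      intro c
      rw [← (Fin.consEquiv (fun _ => Bool)).sum_comp, Fintype.sum_prod_type]
      simp [Fin.consEquiv, Fin.sum_univ_succ, add_assoc]
    rw [key, key]
    calc _ ≤ ∑ b0 : Bool, ∑ e : Fin s → Bool, (⨆ k, ((g k + sgn b0 * a 0 k) + ∑ t : Fin s, sgn (e t) * b t.succ k)) := by
            apply Finset.sum_le_sum
            intro b0 _
            exact ih (fun k => g k + sgn b0 * a 0 k) _ _ (fun t => h t.succ)
      _ ≤ _ := by
        rw [Finset.sum_comm, Finset.sum_comm (s := (univ : Finset Bool))]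
        apply Finset.sum_le_sum
        intro e _
        have := contr_pair (fun k => g k + ∑ t : Fin s, sgn (e t) * b t.succ k) (a 0) (b 0) (h 0)
        have s1 : sgn true = 1 := by simp [sgn]
        have s2 : sgn false = -1 := by simp [sgn]
        simp only [Fintype.sum_bool, s1, s2]
        refine le_trans (le_of_eq ?_) (le_trans this (le_of_eq ?_)) <;>
          (congr 1 <;> (congr 1; funext k; ring))

/-- product probability -/
def PP {Ω : Type*} {s : ℕ} (q : Ω → ℝ) (S : Fin s → Ω) : ℝ := ∏ t, q (S t)

section
variable {Ω : Type*} [Fintype Ω] {s : ℕ} (q : Ω → ℝ)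

lemma PP_nonneg (hq : ∀ w, 0 ≤ q w) (S : Fin s → Ω) : 0 ≤ PP q S :=
  Finset.prod_nonneg fun _ _ => hq _

lemma PP_sum_prod (g : Ω → ℝ) : ∑ S : Fin s → Ω, PP q S * ∏ t, g (S t) = (∑ w, q w * g w) ^ s := by
  have := Finset.prod_univ_sum (fun _ : Fin s => (univ : Finset Ω)) (fun _ w => q w * g w)
  simp only [Finset.prod_const, Finset.card_univ, Fintype.card_fin, Fintype.piFinset_univ] at this
  rw [this]
  simp [PP, Finset.prod_mul_distrib]

lemma PP_sum (hq1 : ∑ w, q w = 1) : ∑ S : Fin s → Ω, PP q S = 1 := by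
  have := PP_sum_prod (s := s) q (fun _ => 1)
  simpa [hq1] using this

lemma PP_marg (hq1 : ∑ w, q w = 1) (g : Ω → ℝ) (t : Fin s) :
    ∑ S : Fin s → Ω, PP q S * g (S t) = ∑ w, q w * g w := by
  have := Finset.prod_univ_sum (fun _ : Fin s => (univ : Finset Ω))
    (fun u w => q w * if u = t then g w else 1)
  simp only [Fintype.piFinset_univ, Finset.prod_mul_distrib, Finset.prod_ite_eq', Finset.mem_univ, if_true] at this
  unfold PP
  rw [← this, ← Finset.mul_prod_erase univ _ (Finset.mem_univ t)]
  simp only [if_true]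
  rw [Finset.prod_eq_one, mul_one]
  intro u hu
  simp [Finset.ne_of_mem_erase hu, hq1]

lemma PP_swap (e : Fin s → Bool) (G : (Fin s → Ω) → (Fin s → Ω) → ℝ) :
    ∑ S : Fin s → Ω, ∑ S' : Fin s → Ω, PP q S * PP q S' * G S S' =
    ∑ S : Fin s → Ω, ∑ S' : Fin s → Ω, PP q S * PP q S' *
      G (fun t => if e t then S t else S' t) (fun t => if e t then S' t else S t) := by
  rw [← Fintype.sum_prod_type', ← Fintype.sum_prod_type']
  let φ : (Fin s → Ω) × (Fin s → Ω) → (Fin s → Ω) × (Fin s → Ω) := fun x =>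
    (fun t => if e t then x.1 t else x.2 t, fun t => if e t then x.2 t else x.1 t)
  have hφ : Function.Involutive φ := by
    rintro ⟨a, b⟩
    simp only [φ, Prod.mk.injEq]
    constructor <;> funext t <;> cases e t <;> simp
  rw [← Equiv.sum_comp (hφ.toPerm φ)]
  apply Finset.sum_congr rfl
  rintro ⟨a, b⟩ _
  simp only [Function.Involutive.coe_toPerm, φ]
  congr 1
  unfold PP
  rw [← Finset.prod_mul_distrib, ← Finset.prod_mul_distrib]
  apply Finset.prod_congr rfl
  intro t _
  by_cases h : e t = true <;> simp [h, mul_comm]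

lemma symmetrization {K : Type*} [Fintype K] [Nonempty K] (hq : ∀ w, 0 ≤ q w) (hq1 : ∑ w, q w = 1)
    (f : K → Ω → ℝ) :
    2 ^ s * ∑ S : Fin s → Ω, PP q S * (⨆ k, (s * (∑ w, q w * f k w) - ∑ t, f k (S t))) ≤
    2 * ∑ S : Fin s → Ω, PP q S * ∑ e : Fin s → Bool, (⨆ k, (∑ t, sgn (e t) * f k (S t))) := by
  have hL : ∀ k, s * (∑ w, q w * f k w) = ∑ S' : Fin s → Ω, PP q S' * ∑ t, f k (S' t) := by
    intro k
    simp only [Finset.mul_sum]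
    rw [Finset.sum_comm]
    simp only [PP_marg q hq1]
    simp [Finset.mul_sum]
  have h1 : ∑ S : Fin s → Ω, PP q S * (⨆ k, (s * (∑ w, q w * f k w) - ∑ t, f k (S t))) ≤
     ∑ S : Fin s → Ω, ∑ S' : Fin s → Ω, PP q S * PP q S' * (⨆ k, (∑ t, (f k (S' t) - f k (S t)))) := by
    apply Finset.sum_le_sum
    intro S _
    simp only [mul_assoc]
    rw [← Finset.mul_sum]
    apply mul_le_mul_of_nonneg_left _ (PP_nonneg q hq S)
    apply ciSup_le
    intro k
    rw [hL]
    have : ∑ t, f k (S t) = ∑ S' : Fin s → Ω, PP q S' * ∑ t, f k (S t) := by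
      rw [← Finset.sum_mul, PP_sum q hq1, one_mul]
    rw [this, ← Finset.sum_sub_distrib]
    apply Finset.sum_le_sum
    intro S' _
    rw [← mul_sub]
    apply mul_le_mul_of_nonneg_left _ (PP_nonneg q hq S')
    rw [← Finset.sum_sub_distrib]
    exact le_fsup (fun k => ∑ t, (f k (S' t) - f k (S t))) k
  have h2 : ∀ e : Fin s → Bool, ∑ S : Fin s → Ω, ∑ S' : Fin s → Ω, PP q S * PP q S' * (⨆ k, (∑ t, (f k (S' t) - f k (S t)))) ≤
      ∑ S : Fin s → Ω, PP q S * (⨆ k, (∑ t, sgn (e t) * f k (S t))) +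
      ∑ S : Fin s → Ω, PP q S * (⨆ k, (∑ t, sgn (!e t) * f k (S t))) := by
    intro e
    rw [PP_swap q e]
    have e1 : ∑ S : Fin s → Ω, PP q S * (⨆ k, (∑ t, sgn (e t) * f k (S t))) =
       ∑ S : Fin s → Ω, ∑ S' : Fin s → Ω, PP q S * PP q S' * (⨆ k, (∑ t, sgn (e t) * f k (S' t))) := by
      simp only [mul_assoc, ← Finset.mul_sum]
      rw [← Finset.sum_mul, PP_sum q hq1, one_mul]
    have e2 : ∑ S : Fin s → Ω, PP q S * (⨆ k, (∑ t, sgn (!e t) * f k (S t))) =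
       ∑ S : Fin s → Ω, ∑ S' : Fin s → Ω, PP q S * PP q S' * (⨆ k, (∑ t, sgn (!e t) * f k (S t))) := by
      apply Finset.sum_congr rfl
      intro S _
      rw [← Finset.sum_mul, ← Finset.mul_sum, PP_sum q hq1, mul_one]
    rw [e1, e2, ← Finset.sum_add_distrib]
    apply Finset.sum_le_sum
    intro S _
    rw [← Finset.sum_add_distrib]
    apply Finset.sum_le_sum
    intro S' _
    rw [← mul_add]
    apply mul_le_mul_of_nonneg_left _ (mul_nonneg (PP_nonneg q hq S) (PP_nonneg q hq S'))
    apply ciSup_le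
    intro k
    have a1 := le_fsup (fun k => ∑ t, sgn (e t) * f k (S' t)) k
    have a2 := le_fsup (fun k => ∑ t, sgn (!e t) * f k (S t)) k
    refine le_trans (le_of_eq ?_) (add_le_add a1 a2)
    simp only
    rw [← Finset.sum_add_distrib]
    apply Finset.sum_congr rfl
    intro t _
    cases e t <;> simp [sgn] <;> ring
  have h3 := Finset.sum_le_sum (fun e (_ : e ∈ (univ : Finset (Fin s → Bool))) => h2 e)
  have h4 : ∑ e : Fin s → Bool, ∑ S : Fin s → Ω, PP q S * (⨆ k, (∑ t, sgn (!e t) * f k (S t))) =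
     ∑ e : Fin s → Bool, ∑ S : Fin s → Ω, PP q S * (⨆ k, (∑ t, sgn (e t) * f k (S t))) := by
    have hi : Function.Involutive (fun (e : Fin s → Bool) t => !e t) := by
      intro e; funext t; simp
    exact Equiv.sum_comp (hi.toPerm _) (fun e : Fin s → Bool => ∑ S : Fin s → Ω, PP q S * (⨆ k, (∑ t, sgn (e t) * f k (S t))))
  rw [Finset.sum_add_distrib, h4] at h3
  simp only [Finset.sum_const, Finset.card_univ, Fintype.card_fun, Fintype.card_bool, Fintype.card_fin, nsmul_eq_mul] at h3
  push_cast at h3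
  have h5 : ∑ S : Fin s → Ω, PP q S * ∑ e : Fin s → Bool, (⨆ k, (∑ t, sgn (e t) * f k (S t))) =
     ∑ e : Fin s → Bool, ∑ S : Fin s → Ω, PP q S * (⨆ k, (∑ t, sgn (e t) * f k (S t))) := by
    rw [Finset.sum_comm]
    simp only [Finset.mul_sum]
  rw [h5, two_mul]
  exact le_trans (mul_le_mul_of_nonneg_left h1 (by positivity)) h3
end

lemma spectral_sym {ι : Type*} [Fintype ι] [DecidableEq ι] (A : Matrix ι ι ℝ) (hA : Aᵀ = A) :
    ∃ (U : Matrix ι ι ℝ) (d : ι → ℝ), U * Uᵀ = 1 ∧ Uᵀ * U = 1 ∧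
      ∀ k : ℕ, A ^ k = U * diagonal (fun i => d i ^ k) * Uᵀ := by
  have hH : A.IsHermitian := by
    rw [Matrix.IsHermitian, Matrix.conjTranspose_eq_transpose_of_trivial, hA]
  have h1 := hH.spectral_theorem
  rw [Unitary.conjStarAlgAut_apply] at h1
  have h2 := Unitary.mul_star_self_of_mem hH.eigenvectorUnitary.2
  have h3 := Unitary.star_mul_self_of_mem hH.eigenvectorUnitary.2
  simp only [Matrix.star_eq_conjTranspose, Matrix.conjTranspose_eq_transpose_of_trivial] at h1 h2 h3
  refine ⟨hH.eigenvectorUnitary, hH.eigenvalues, h2, h3, ?_⟩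
  intro k
  induction k with
  | zero => simp [h2]
  | succ k ih =>
    rw [pow_succ, ih]
    refine (congrArg _ h1).trans ?_
    generalize (hH.eigenvectorUnitary : Matrix ι ι ℝ) = U at h2 h3 ⊢
    have : ∀ D E : Matrix ι ι ℝ, U * D * Uᵀ * (U * E * Uᵀ) = U * (D * E) * Uᵀ := by
      intro D E
      calc _ = U * D * (Uᵀ * U) * E * Uᵀ := by simp only [Matrix.mul_assoc]
        _ = _ := by rw [h3]; simp only [Matrix.mul_assoc, Matrix.mul_one, Matrix.one_mul]
    rw [this, Matrix.diagonal_mul_diagonal]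
    congr 3

lemma trace_expand {ι : Type*} [Fintype ι] [DecidableEq ι] (H U V : Matrix ι ι ℝ) (hH : Hᵀ = H) (a b : ι → ℝ) :
    trace (H * (U * diagonal a * Uᵀ) * H * (V * diagonal b * Vᵀ)) =
      ∑ i, ∑ j, a i * b j * ((Uᵀ * H * V) i j) ^ 2 := by
  have h1 : trace (H * (U * diagonal a * Uᵀ) * H * (V * diagonal b * Vᵀ)) =
      trace ((Uᵀ * H * V)ᵀ * (diagonal a * (Uᵀ * H * V) * diagonal b)) := by
    rw [← Matrix.mul_assoc, Matrix.trace_mul_comm]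
    simp only [Matrix.transpose_mul, Matrix.transpose_transpose, hH, Matrix.mul_assoc]
  rw [h1, Matrix.trace, Finset.sum_comm]
  apply Finset.sum_congr rfl
  intro j _
  rw [Matrix.diag_apply, Matrix.mul_apply]
  apply Finset.sum_congr rfl
  intro i _
  rw [Matrix.mul_diagonal, Matrix.diagonal_mul, Matrix.transpose_apply]
  ring

lemma scalar_amgm (a b : ℝ) (q r k : ℕ) (h : q + r = 2 * k) :
    a ^ q * b ^ r + a ^ r * b ^ q ≤ a ^ (2 * k) + b ^ (2 * k) := by
  have h1 : ∀ q r : ℕ, a ^ q * b ^ r ≤ |a| ^ q * |b| ^ r := by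
    intro q r
    refine le_trans (le_abs_self _) (le_of_eq ?_)
    rw [abs_mul, abs_pow, abs_pow]
  have h2 : ∀ x : ℝ, x ^ (2 * k) = |x| ^ q * |x| ^ r := by
    intro x
    rw [← pow_add, h, pow_mul, pow_mul, sq_abs]
  rw [h2 a, h2 b]
  have h3 : 0 ≤ (|a| ^ q - |b| ^ q) * (|a| ^ r - |b| ^ r) := by
    rcases le_total |a| |b| with hab | hab
    · exact mul_nonneg_of_nonpos_of_nonpos
        (sub_nonpos.2 (pow_le_pow_left₀ (abs_nonneg _) hab _))
        (sub_nonpos.2 (pow_le_pow_left₀ (abs_nonneg _) hab _))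
    · exact mul_nonneg
        (sub_nonneg.2 (pow_le_pow_left₀ (abs_nonneg _) hab _))
        (sub_nonneg.2 (pow_le_pow_left₀ (abs_nonneg _) hab _))
  have := h1 q r
  have := h1 r q
  nlinarith

lemma trace_amgm {ι : Type*} [Fintype ι] [DecidableEq ι] (H W Y : Matrix ι ι ℝ) (hH : Hᵀ = H) (hW : Wᵀ = W)
    (hY : Yᵀ = Y) (q r k : ℕ) (h : q + r = 2 * k) :
    trace (H * W ^ q * H * Y ^ r) + trace (H * W ^ r * H * Y ^ q) ≤
      trace (H * H * W ^ (2 * k)) + trace (H * H * Y ^ (2 * k)) := by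
  obtain ⟨U, d, _, _, hU⟩ := spectral_sym W hW
  obtain ⟨V, e, _, _, hV⟩ := spectral_sym Y hY
  have e1 : trace (H * H * W ^ (2 * k)) = trace (H * W ^ (2 * k) * H * Y ^ 0) := by
    rw [pow_zero, Matrix.mul_one, Matrix.trace_mul_cycle, Matrix.trace_mul_cycle]
  have e2 : trace (H * H * Y ^ (2 * k)) = trace (H * W ^ 0 * H * Y ^ (2 * k)) := by
    rw [pow_zero, Matrix.mul_one]
  rw [e1, e2]
  simp only [hU, hV, trace_expand H U V hH]
  simp only [← Finset.sum_add_distrib]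
  apply Finset.sum_le_sum
  intro i _
  apply Finset.sum_le_sum
  intro j _
  have := scalar_amgm (d i) (e j) q r k h
  have h0 := sq_nonneg ((Uᵀ * H * V) i j)
  rw [← add_mul, ← add_mul]
  apply mul_le_mul_of_nonneg_right _ h0
  simpa using this

lemma pow_sub_pow_nc {R : Type*} [Ring R] (x y : R) (n : ℕ) :
    x ^ (n + 1) - y ^ (n + 1) = ∑ q ∈ range (n + 1), x ^ q * (x - y) * y ^ (n - q) := by
  induction n with
  | zero => simp
  | succ n ih =>
    rw [Finset.sum_range_succ]
    have : ∀ q ∈ range (n + 1), x ^ q * (x - y) * y ^ (n + 1 - q) = x ^ q * (x - y) * y ^ (n - q) * y := by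
      intro q hq
      have : n + 1 - q = (n - q) + 1 := by
        have := Finset.mem_range.1 hq; omega
      rw [this, pow_succ, ← mul_assoc]
    rw [Finset.sum_congr rfl this, ← Finset.sum_mul, ← ih]
    simp only [Nat.sub_self, pow_zero, mul_one, sub_mul, mul_sub, ← pow_succ]
    abel

def XX {ι : Type*} {s : ℕ} (H : Fin s → Matrix ι ι ℝ) (e : Fin s → Bool) : Matrix ι ι ℝ :=
  ∑ t, sgn (e t) • H t

def flip1 {s : ℕ} (t : Fin s) (e : Fin s → Bool) : Fin s → Bool := Function.update e t (!e t)

lemma flip1_inv {s : ℕ} (t : Fin s) : Function.Involutive (flip1 t) := by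
  intro e; funext u; unfold flip1
  by_cases h : u = t
  · subst h; simp
  · simp [h]

lemma flip1_sum {s : ℕ} (t : Fin s) (F : (Fin s → Bool) → ℝ) : ∑ e, F (flip1 t e) = ∑ e, F e :=
  Equiv.sum_comp ((flip1_inv t).toPerm _) F

lemma XX_flip {ι : Type*} {s : ℕ} (H : Fin s → Matrix ι ι ℝ) (e : Fin s → Bool) (t : Fin s) :
    XX H e - XX H (flip1 t e) = (2 * sgn (e t)) • H t := by
  unfold XX
  rw [← Finset.sum_sub_distrib, Finset.sum_eq_single t]
  · simp only [flip1, Function.update_self, sgn_not]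
    rw [← sub_smul]; congr 1; ring
  · intro u _ hu
    simp [flip1, hu]
  · simp

lemma XX_sym {ι : Type*} {s : ℕ} (H : Fin s → Matrix ι ι ℝ) (hH : ∀ t, (H t)ᵀ = H t) (e : Fin s → Bool) :
    (XX H e)ᵀ = XX H e := by
  unfold XX
  rw [Matrix.transpose_sum]
  simp [hH]

lemma khin_one {ι : Type*} [Fintype ι] [DecidableEq ι] {s : ℕ} (H : Fin s → Matrix ι ι ℝ) (hH : ∀ t, (H t)ᵀ = H t)
    (k : ℕ) (t : Fin s) :
    ∑ e, sgn (e t) * trace (H t * XX H e ^ (2 * k + 1)) ≤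
      (2 * k + 1) * ∑ e, trace (H t * H t * XX H e ^ (2 * k)) := by
  have h1 : ∑ e, sgn (e t) * trace (H t * XX H e ^ (2 * k + 1)) =
     ∑ e, - (sgn (e t) * trace (H t * XX H (flip1 t e) ^ (2 * k + 1))) := by
    rw [← flip1_sum t]
    apply Finset.sum_congr rfl
    intro e _
    have : sgn (flip1 t e t) = - sgn (e t) := by simp [flip1, sgn_not]
    rw [this]; ring
  have h2 : ∀ e : Fin s → Bool, sgn (e t) * trace (H t * XX H e ^ (2 * k + 1))
      + - (sgn (e t) * trace (H t * XX H (flip1 t e) ^ (2 * k + 1))) =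
      2 * ∑ q ∈ range (2 * k + 1), trace (H t * XX H e ^ q * H t * XX H (flip1 t e) ^ (2 * k - q)) := by
    intro e
    rw [← sub_eq_add_neg, ← mul_sub, ← Matrix.trace_sub, ← Matrix.mul_sub, pow_sub_pow_nc, XX_flip,
      Matrix.mul_sum, Matrix.trace_sum, Finset.mul_sum, Finset.mul_sum]
    apply Finset.sum_congr rfl
    intro q _
    rw [Matrix.mul_smul, Matrix.smul_mul, Matrix.mul_smul, Matrix.trace_smul, smul_eq_mul]
    simp only [← Matrix.mul_assoc]
    have := sgn_sq (e t)
    linear_combination 2 * (H t * XX H e ^ q * H t * XX H (flip1 t e) ^ (2 * k - q)).trace * this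
  have h3 : ∀ e : Fin s → Bool, 2 * ∑ q ∈ range (2 * k + 1), trace (H t * XX H e ^ q * H t * XX H (flip1 t e) ^ (2 * k - q))
      ≤ (2 * k + 1) * (trace (H t * H t * XX H e ^ (2 * k)) + trace (H t * H t * XX H (flip1 t e) ^ (2 * k))) := by
    intro e
    rw [two_mul]
    nth_rw 2 [← Finset.sum_range_reflect]
    rw [← Finset.sum_add_distrib]
    have : ∀ q ∈ range (2 * k + 1), trace (H t * XX H e ^ q * H t * XX H (flip1 t e) ^ (2 * k - q)) +
       trace (H t * XX H e ^ (2 * k + 1 - 1 - q) * H t * XX H (flip1 t e) ^ (2 * k - (2 * k + 1 - 1 - q))) ≤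
       (trace (H t * H t * XX H e ^ (2 * k)) + trace (H t * H t * XX H (flip1 t e) ^ (2 * k))) := by
      intro q hq
      have hq := Finset.mem_range.1 hq
      have e1 : 2 * k + 1 - 1 - q = 2 * k - q := by omega
      have e2 : 2 * k - (2 * k - q) = q := by omega
      rw [e1, e2]
      exact trace_amgm _ _ _ (hH t) (XX_sym H hH _) (XX_sym H hH _) _ _ _ (by omega)
    refine le_trans (Finset.sum_le_sum this) (le_of_eq ?_)
    rw [Finset.sum_const, Finset.card_range, nsmul_eq_mul]
    push_cast; ring
  have h4 := Finset.sum_le_sum (fun e (_ : e ∈ (univ : Finset (Fin s → Bool))) => h3 e)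
  simp only [← h2] at h4
  rw [Finset.sum_add_distrib, ← h1, ← Finset.mul_sum, Finset.sum_add_distrib,
    flip1_sum t (fun e => trace (H t * H t * XX H e ^ (2 * k)))] at h4
  linarith

lemma khintchine {ι : Type*} [Fintype ι] [DecidableEq ι] {s : ℕ} (H : Fin s → Matrix ι ι ℝ) (hH : ∀ t, (H t)ᵀ = H t)
    (v : ℝ) (hv : 0 ≤ v)
    (hσ : ∀ e k, ∑ t, trace (H t * H t * XX H e ^ (2 * k)) ≤ v * trace (XX H e ^ (2 * k))) (k : ℕ) :
    ∑ e, trace (XX H e ^ (2 * k)) ≤ (2 * k * v) ^ k * (2 ^ s * Fintype.card ι) := by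
  have step : ∀ j : ℕ, ∑ e, trace (XX H e ^ (2 * (j + 1))) ≤ (2 * j + 1) * v * ∑ e, trace (XX H e ^ (2 * j)) := by
    intro j
    have e1 : ∀ e, trace (XX H e ^ (2 * (j + 1))) = ∑ t, sgn (e t) * trace (H t * XX H e ^ (2 * j + 1)) := by
      intro e
      rw [show 2 * (j + 1) = (2 * j + 1) + 1 by ring, pow_succ']
      nth_rw 1 [XX]
      rw [Matrix.sum_mul, Matrix.trace_sum]
      simp
    simp only [e1]
    rw [Finset.sum_comm]
    refine le_trans (Finset.sum_le_sum fun t _ => khin_one H hH j t) ?_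
    rw [← Finset.mul_sum, Finset.sum_comm, mul_assoc]
    apply mul_le_mul_of_nonneg_left _ (by positivity)
    rw [Finset.mul_sum]
    exact Finset.sum_le_sum fun e _ => hσ e j
  have main : ∀ j : ℕ, j ≤ k → ∑ e, trace (XX H e ^ (2 * j)) ≤ (2 * k * v) ^ j * (2 ^ s * Fintype.card ι) := by
    intro j
    induction j with
    | zero => intro _; simp
    | succ j ih =>
      intro hj
      have ih := ih (by omega)
      have hjk : (j : ℝ) + 1 ≤ k := by exact_mod_cast hj
      calc _ ≤ (2 * j + 1) * v * ∑ e, trace (XX H e ^ (2 * j)) := step j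
        _ ≤ (2 * j + 1) * v * ((2 * k * v) ^ j * (2 ^ s * Fintype.card ι)) :=
            mul_le_mul_of_nonneg_left ih (by positivity)
        _ ≤ (2 * k * v) * ((2 * k * v) ^ j * (2 ^ s * Fintype.card ι)) := by
            apply mul_le_mul_of_nonneg_right _ (by positivity)
            apply mul_le_mul_of_nonneg_right _ hv
            linarith
        _ = _ := by ring
  exact main k le_rfl

/-- quadratic form bound by trace moments -/
lemma quad_bound {ι : Type*} [Fintype ι] [DecidableEq ι] (A : Matrix ι ι ℝ) (hA : Aᵀ = A) (z : ι → ℝ) (k : ℕ) (hk : 0 < k)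
    (c : ℝ) (hc : 0 < c) :
    z ⬝ᵥ (A *ᵥ z) ≤ (c * (1 + trace (A ^ (2 * k)) / c ^ (2 * k))) * (z ⬝ᵥ z) := by
  obtain ⟨U, d, hU1, hU2, hU⟩ := spectral_sym A hA
  have hA1 := hU 1
  rw [pow_one] at hA1
  have e1 : z ⬝ᵥ (A *ᵥ z) = ∑ i, d i * (Uᵀ *ᵥ z) i ^ 2 := by
    rw [hA1, ← Matrix.mulVec_mulVec, ← Matrix.mulVec_mulVec, Matrix.dotProduct_mulVec,
      ← Matrix.mulVec_transpose, dotProduct]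
    apply Finset.sum_congr rfl
    intro i _
    rw [Matrix.mulVec_diagonal]
    ring
  have e2 : z ⬝ᵥ z = ∑ i, (Uᵀ *ᵥ z) i ^ 2 := by
    have : z ⬝ᵥ z = z ⬝ᵥ ((U * Uᵀ) *ᵥ z) := by rw [hU1, Matrix.one_mulVec]
    rw [this, ← Matrix.mulVec_mulVec, Matrix.dotProduct_mulVec, ← Matrix.mulVec_transpose, dotProduct]
    apply Finset.sum_congr rfl
    intro i _
    ring
  have e3 : trace (A ^ (2 * k)) = ∑ i, d i ^ (2 * k) := by
    rw [hU, Matrix.trace_mul_cycle, hU2, Matrix.one_mul, Matrix.trace_diagonal]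
  rw [e1, e2, Finset.mul_sum]
  apply Finset.sum_le_sum
  intro i _
  apply mul_le_mul_of_nonneg_right _ (sq_nonneg _)
  have h1 : d i ^ (2 * k) ≤ trace (A ^ (2 * k)) := by
    rw [e3]
    exact Finset.single_le_sum (f := fun i => d i ^ (2 * k)) (fun j _ => by rw [pow_mul]; positivity) (Finset.mem_univ i)
  have h2 : d i ≤ c * (1 + (d i / c) ^ (2 * k)) := by
    have hnn : 0 ≤ (d i / c) ^ (2 * k) := by rw [pow_mul]; positivity
    have hd : d i = c * (d i / c) := by field_simp
    by_cases hx : d i / c ≤ 1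
    · nth_rw 1 [hd]; apply mul_le_mul_of_nonneg_left _ hc.le; linarith
    · push Not at hx
      · have := le_self_pow₀ hx.le (show 2 * k ≠ 0 by omega)
        nth_rw 1 [hd]; apply mul_le_mul_of_nonneg_left _ hc.le; linarith
  refine le_trans h2 ?_
  apply mul_le_mul_of_nonneg_left _ hc.le
  rw [div_pow]
  gcongr

lemma trace_decomp {n m : ℕ} (Z : Matrix (Fin n) (Fin m) ℝ) :
    ∃ (σ : Fin m → ℝ) (w : Fin m → Fin n → ℝ) (v : Fin m → Fin m → ℝ),
      (∀ k, 0 ≤ σ k) ∧ ∑ k, σ k = traceNorm Z ∧ (∀ k, ∑ i, w k i ^ 2 ≤ 1) ∧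
      (∀ k, ∑ j, v k j ^ 2 ≤ 1) ∧ ∀ i j, Z i j = ∑ k, σ k * (w k i * v k j) := by
  have hH := Matrix.isHermitian_conjTranspose_mul_self Z
  have h1 := hH.spectral_theorem
  rw [Unitary.conjStarAlgAut_apply] at h1
  have h2 := Unitary.mul_star_self_of_mem hH.eigenvectorUnitary.2
  have h3 := Unitary.star_mul_self_of_mem hH.eigenvectorUnitary.2
  have hd : ∑ k, Real.sqrt (hH.eigenvalues k) = traceNorm Z := rfl
  generalize (hH.eigenvectorUnitary : Matrix (Fin m) (Fin m) ℝ) = U at h1 h2 h3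
  generalize hH.eigenvalues = d at h1 hd
  simp only [Matrix.star_eq_conjTranspose, Matrix.conjTranspose_eq_transpose_of_trivial] at h1 h2 h3
  have h4 : ∀ k, ∑ i, ((Z * U) i k) ^ 2 = d k := by
    intro k
    have : ((Z * U)ᵀ * (Z * U)) = diagonal d := by
      calc (Z * U)ᵀ * (Z * U) = Uᵀ * (Zᵀ * Z) * U := by
            rw [Matrix.transpose_mul]; simp only [Matrix.mul_assoc]
        _ = (Uᵀ * U) * diagonal d * (Uᵀ * U) := by
            rw [h1]; simp only [Matrix.mul_assoc]; rfl
        _ = _ := by rw [h3]; simp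
    have := congrFun (congrFun this k) k
    rw [Matrix.mul_apply, Matrix.diagonal_apply_eq] at this
    rw [← this]
    apply Finset.sum_congr rfl
    intro i _
    rw [Matrix.transpose_apply, sq]
  have h0 : ∀ k, 0 ≤ d k := fun k => by rw [← h4]; positivity
  refine ⟨fun k => Real.sqrt (d k), fun k i => (Z * U) i k / Real.sqrt (d k), fun k j => U j k,
    fun k => Real.sqrt_nonneg _, hd, ?_, ?_, ?_⟩
  · intro k
    simp only [div_pow]
    rw [← Finset.sum_div, h4, Real.sq_sqrt (h0 k)]
    exact div_self_le_one _
  · intro k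
    have := congrFun (congrFun h3 k) k
    rw [Matrix.mul_apply, Matrix.one_apply_eq] at this
    simp only [Matrix.transpose_apply, ← sq] at this
    exact this.le
  · intro i j
    have : Z = (Z * U) * Uᵀ := by rw [Matrix.mul_assoc, h2, Matrix.mul_one]
    nth_rw 1 [this]
    rw [Matrix.mul_apply]
    apply Finset.sum_congr rfl
    intro k _
    rw [Matrix.transpose_apply]
    by_cases hk : d k = 0
    · have hz : (Z * U) i k = 0 := by
        have h5 := h4 k
        rw [hk, Finset.sum_eq_zero_iff_of_nonneg (fun _ _ => sq_nonneg _)] at h5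
        have := h5 i (Finset.mem_univ i)
        exact pow_eq_zero_iff (two_ne_zero) |>.1 this
      simp [hz]
    · have : Real.sqrt (d k) ≠ 0 := by
        rw [Real.sqrt_ne_zero (h0 k)]; exact hk
      field_simp

/-- atomic decomposition -/
def Atomic {n m : ℕ} (R : ℝ) (X : Matrix (Fin n) (Fin m) ℝ) : Prop :=
    ∃ (σ : Fin m → ℝ) (w : Fin m → Fin n → ℝ) (v : Fin m → Fin m → ℝ),
      (∀ k, 0 ≤ σ k) ∧ ∑ k, σ k ≤ R ∧ (∀ k, ∑ i, w k i ^ 2 ≤ 1) ∧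
      (∀ k, ∑ j, v k j ^ 2 ≤ 1) ∧ ∀ i j, X i j = √n * √m * ∑ k, σ k * (w k i * v k j)

lemma ball_atomic {n m : ℕ} (hn : 0 < n) (hm : 0 < m) (r : ℝ) (pr : Fin n → ℝ) (pc : Fin m → ℝ)
    (hr : ∀ i, pr i = 1 / (n : ℝ)) (hc : ∀ j, pc j = 1 / (m : ℝ))
    (X : Matrix (Fin n) (Fin m) ℝ) (hX : X ∈ Wball pr pc r) : Atomic (√r) X := by
  obtain ⟨σ, w, v, h1, h2, h3, h4, h5⟩ := trace_decomp
    (Matrix.diagonal (fun i => Real.sqrt (pr i)) * X * Matrix.diagonal (fun j => Real.sqrt (pc j)))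
  refine ⟨σ, w, v, h1, ?_, h3, h4, ?_⟩
  · rw [h2]; exact hX
  · intro i j
    rw [← h5, Matrix.mul_diagonal, Matrix.diagonal_mul, hr, hc]
    have a1 : (0:ℝ) < n := by exact_mod_cast hn
    have a2 : (0:ℝ) < m := by exact_mod_cast hm
    have b1 : √(n:ℝ) ≠ 0 := by positivity
    have b2 : √(m:ℝ) ≠ 0 := by positivity
    rw [Real.sqrt_div zero_le_one, Real.sqrt_div zero_le_one, Real.sqrt_one]
    field_simp

lemma atomic_abs {n m : ℕ} (hn : 0 < n) (hm : 0 < m) (R : ℝ) (p : Matrix (Fin n) (Fin m) ℝ)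
    (hp : ∀ i j, 0 ≤ p i j)
    (hr : ∀ i, rowMarg p i = 1 / (n : ℝ)) (hc : ∀ j, colMarg p j = 1 / (m : ℝ))
    (X : Matrix (Fin n) (Fin m) ℝ) (hX : Atomic R X) : ∑ i, ∑ j, p i j * |X i j| ≤ R := by
  obtain ⟨σ, w, v, h1, h2, h3, h4, h5⟩ := hX
  have a1 : (0:ℝ) < n := by exact_mod_cast hn
  have a2 : (0:ℝ) < m := by exact_mod_cast hm
  have key : ∀ k, ∑ i, ∑ j, p i j * (√n * √m * |w k i * v k j|) ≤ 1 := by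
    intro k
    have : ∀ i j, p i j * (√n * √m * |w k i * v k j|) ≤ p i j * ((n * w k i ^ 2 + m * v k j ^ 2) / 2) := by
      intro i j
      apply mul_le_mul_of_nonneg_left _ (hp i j)
      rw [abs_mul]
      have := sq_nonneg (√n * |w k i| - √m * |v k j|)
      have e1 := Real.sq_sqrt a1.le
      have e2 := Real.sq_sqrt a2.le
      have e3 := sq_abs (w k i)
      have e4 := sq_abs (v k j)
      have : (√n * |w k i| - √m * |v k j|) ^ 2 = n * w k i ^ 2 + m * v k j ^ 2 - 2 * (√n * √m * (|w k i| * |v k j|)) := by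
        rw [sub_sq, mul_pow, mul_pow, e1, e2, e3, e4]; ring
      linarith
    refine le_trans (Finset.sum_le_sum fun i _ => Finset.sum_le_sum fun j _ => this i j) ?_
    have e : ∑ i, ∑ j, p i j * ((n * w k i ^ 2 + m * v k j ^ 2) / 2) =
       (n / 2) * ∑ i, rowMarg p i * w k i ^ 2 + (m / 2) * ∑ j, colMarg p j * v k j ^ 2 := by
      simp only [rowMarg, colMarg, Finset.sum_mul, Finset.mul_sum]
      rw [Finset.sum_comm (s := (univ : Finset (Fin m)))]
      rw [← Finset.sum_add_distrib]
      apply Finset.sum_congr rfl; intro i _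
      rw [← Finset.sum_add_distrib]
      apply Finset.sum_congr rfl; intro j _
      ring
    rw [e]
    simp only [hr, hc, ← Finset.mul_sum]
    have := h3 k
    have := h4 k
    field_simp
    linarith
  calc ∑ i, ∑ j, p i j * |X i j| ≤ ∑ i, ∑ j, ∑ k, σ k * (p i j * (√n * √m * |w k i * v k j|)) := by
        apply Finset.sum_le_sum; intro i _
        apply Finset.sum_le_sum; intro j _
        rw [h5, abs_mul, abs_of_nonneg (by positivity : 0 ≤ √(n:ℝ) * √(m:ℝ))]
        refine le_trans (mul_le_mul_of_nonneg_left (mul_le_mul_of_nonneg_left (Finset.abs_sum_le_sum_abs _ _) (by positivity)) (hp i j)) ?_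
        rw [Finset.mul_sum, Finset.mul_sum]
        apply Finset.sum_le_sum; intro k _
        rw [abs_mul, abs_of_nonneg (h1 k)]
        apply le_of_eq; ring
    _ = ∑ k, σ k * ∑ i, ∑ j, (p i j * (√n * √m * |w k i * v k j|)) := by
        simp only [Finset.mul_sum]
        rw [Finset.sum_comm' (t' := univ) (s' := fun _ => univ) (by simp)]
        rw [Finset.sum_congr rfl fun i _ => Finset.sum_comm]
        rw [Finset.sum_comm]
        rw [Finset.sum_congr rfl fun i _ => Finset.sum_comm]
    _ ≤ ∑ k, σ k * 1 := Finset.sum_le_sum fun k _ => mul_le_mul_of_nonneg_left (key k) (h1 k)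
    _ ≤ R := by simpa using h2

/-- incidence indicator -/
def ind {n m : ℕ} (b : Fin n ⊕ Fin m) (x : Fin n × Fin m) : ℝ :=
  Sum.elim (fun i => if x.1 = i then 1 else 0) (fun j => if x.2 = j then 1 else 0) b

def dil {n m : ℕ} (x : Fin n × Fin m) : Matrix (Fin n ⊕ Fin m) (Fin n ⊕ Fin m) ℝ :=
  Matrix.single (Sum.inl x.1) (Sum.inr x.2) 1 + Matrix.single (Sum.inr x.2) (Sum.inl x.1) 1

lemma dil_sym {n m : ℕ} (x : Fin n × Fin m) : (dil x)ᵀ = dil x := by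
  unfold dil
  rw [Matrix.transpose_add, Matrix.transpose_single, Matrix.transpose_single, add_comm]

lemma dil_sq {n m : ℕ} (x : Fin n × Fin m) (P : Matrix (Fin n ⊕ Fin m) (Fin n ⊕ Fin m) ℝ) :
    trace (dil x * dil x * P) = ∑ b, ind b x * P b b := by
  have : dil x * dil x = Matrix.single (Sum.inl x.1) (Sum.inl x.1) (1:ℝ) + Matrix.single (Sum.inr x.2) (Sum.inr x.2) 1 := by
    unfold dil
    simp [add_mul, mul_add, add_comm]
  rw [this, Matrix.add_mul, Matrix.trace_add]
  have h : ∀ a, trace (Matrix.single a a (1:ℝ) * P) = P a a := by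
    intro a
    rw [Matrix.trace_single_mul]; simp
  rw [h, h]
  simp [ind]

lemma dil_quad {n m : ℕ} (x : Fin n × Fin m) (w : Fin n → ℝ) (v : Fin m → ℝ) :
    (Sum.elim w v) ⬝ᵥ (dil x *ᵥ (Sum.elim w v)) = 2 * (w x.1 * v x.2) := by
  unfold dil
  rw [Matrix.add_mulVec, dotProduct_add, Matrix.single_mulVec, Matrix.single_mulVec]
  simp [dotProduct, Function.update_apply]
  ring

lemma even_pow_diag {ι : Type*} [Fintype ι] [DecidableEq ι] (Q : Matrix ι ι ℝ) (hQ : Qᵀ = Q) (k : ℕ) (b : ι) :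
    0 ≤ (Q ^ (2 * k)) b b := by
  have h : (Q ^ k)ᵀ = Q ^ k := by rw [Matrix.transpose_pow, hQ]
  rw [two_mul, pow_add]
  nth_rw 1 [← h]
  rw [Matrix.mul_apply]
  apply Finset.sum_nonneg
  intro j _
  rw [Matrix.transpose_apply]
  exact mul_self_nonneg _

lemma rade_bound {n m s : ℕ} {K : Type*} [Fintype K] [Nonempty K] (S : Fin s → Fin n × Fin m) (v R : ℝ)
    (hR : 0 ≤ R)
    (hv : 0 < v) (hcount : ∀ b, ∑ t, ind b (S t) ≤ v) (k : ℕ) (hk : 0 < k)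
    (hkn : (n : ℝ) + m ≤ Real.exp (2 * k)) (X : K → Matrix (Fin n) (Fin m) ℝ) (hX : ∀ a, Atomic R (X a)) :
    ∑ e : Fin s → Bool, (⨆ a, ∑ t, sgn (e t) * X a (S t).1 (S t).2) ≤
      2 ^ s * (√n * √m * R * (2 * Real.exp 1 * √(2 * k * v))) := by
  set H : Fin s → Matrix (Fin n ⊕ Fin m) (Fin n ⊕ Fin m) ℝ := fun t => dil (S t) with hHdef
  have hH : ∀ t, (H t)ᵀ = H t := fun t => dil_sym _
  have hkh := khintchine H hH v hv.le (by
    intro e j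
    simp only [hHdef, dil_sq]
    rw [Finset.sum_comm, Matrix.trace, Finset.mul_sum]
    apply Finset.sum_le_sum
    intro b _
    rw [← Finset.sum_mul]
    exact mul_le_mul_of_nonneg_right (hcount b) (even_pow_diag _ (XX_sym H hH e) j b)) k
  have hk' : (0:ℝ) < k := by exact_mod_cast hk
  set c : ℝ := Real.exp 1 * √(2 * k * v) with hc
  have hc0 : 0 < c := by positivity
  have hck : c ^ (2 * k) = Real.exp (2 * k) * (2 * k * v) ^ k := by
    rw [hc, mul_pow, pow_mul √_, Real.sq_sqrt (by positivity), ← Real.exp_nat_mul]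
    push_cast; ring_nf
  have hB0 : ∀ e, 0 ≤ c * (1 + trace (XX H e ^ (2 * k)) / c ^ (2 * k)) := by
    intro e
    have : 0 ≤ trace (XX H e ^ (2 * k)) := Finset.sum_nonneg fun b _ => by
      rw [Matrix.diag_apply]; exact even_pow_diag _ (XX_sym H hH e) k b
    positivity
  have hsup : ∀ e : Fin s → Bool, (⨆ a, ∑ t, sgn (e t) * X a (S t).1 (S t).2) ≤
      √n * √m * R * (c * (1 + trace (XX H e ^ (2 * k)) / c ^ (2 * k))) := by
    intro e
    apply ciSup_le
    intro a
    obtain ⟨σ, w, u, h1, h2, h3, h4, h5⟩ := hX a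
    have q : ∀ i, ∑ t, sgn (e t) * (w i (S t).1 * u i (S t).2) ≤ c * (1 + trace (XX H e ^ (2 * k)) / c ^ (2 * k)) := by
      intro i
      have := quad_bound (XX H e) (XX_sym H hH e) (Sum.elim (w i) (u i)) k hk c hc0
      have e1 : (Sum.elim (w i) (u i)) ⬝ᵥ (XX H e *ᵥ (Sum.elim (w i) (u i))) =
          2 * ∑ t, sgn (e t) * (w i (S t).1 * u i (S t).2) := by
        unfold XX
        rw [Matrix.sum_mulVec, dotProduct_sum, Finset.mul_sum]
        apply Finset.sum_congr rfl
        intro t _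
        rw [Matrix.smul_mulVec, dotProduct_smul, dil_quad, smul_eq_mul]
        ring
      have e2 : (Sum.elim (w i) (u i)) ⬝ᵥ (Sum.elim (w i) (u i)) ≤ 2 := by
        rw [dotProduct, Fintype.sum_sum_type]
        simp only [Sum.elim_inl, Sum.elim_inr, ← sq]
        have := h3 i; have := h4 i; linarith
      rw [e1] at this
      have := this.trans (mul_le_mul_of_nonneg_left e2 (hB0 e))
      linarith
    have e3 : ∑ t, sgn (e t) * X a (S t).1 (S t).2 = √n * √m * ∑ i, σ i * ∑ t, sgn (e t) * (w i (S t).1 * u i (S t).2) := by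
      simp only [h5, Finset.mul_sum]
      rw [Finset.sum_comm]
      apply Finset.sum_congr rfl; intro i _
      apply Finset.sum_congr rfl; intro t _
      ring
    rw [e3, mul_assoc (√(n:ℝ) * √(m:ℝ))]
    apply mul_le_mul_of_nonneg_left _ (by positivity)
    refine le_trans (Finset.sum_le_sum fun i _ => mul_le_mul_of_nonneg_left (q i) (h1 i)) ?_
    rw [← Finset.sum_mul]
    exact mul_le_mul_of_nonneg_right h2 (hB0 e)
  refine le_trans (Finset.sum_le_sum fun e _ => hsup e) ?_
  rw [← Finset.mul_sum, ← Finset.mul_sum, Finset.sum_add_distrib, ← Finset.sum_div]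
  have h6 : (∑ e, trace (XX H e ^ (2 * k))) / c ^ (2 * k) ≤ 2 ^ s := by
    rw [div_le_iff₀ (by positivity)]
    refine hkh.trans ?_
    rw [hck]
    simp only [Fintype.card_sum, Fintype.card_fin]
    push_cast
    have : (2 * k * v) ^ k * (2 ^ s * ((n:ℝ) + m)) ≤ (2 * k * v) ^ k * (2 ^ s * Real.exp (2 * k)) := by gcongr
    linarith
  have h7 : ∑ e : Fin s → Bool, (1:ℝ) = 2 ^ s := by simp
  rw [h7]
  calc √n * √m * R * (c * (2 ^ s + (∑ e, trace (XX H e ^ (2 * k))) / c ^ (2 * k)))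
      ≤ √n * √m * R * (c * (2 ^ s + 2 ^ s)) := by gcongr
    _ = _ := by rw [hc]; ring

lemma sum_ind {n m : ℕ} (p : Matrix (Fin n) (Fin m) ℝ) (hm : 0 < m) (hmn : m ≤ n)
    (hr : ∀ i, rowMarg p i = 1 / (n : ℝ)) (hc : ∀ j, colMarg p j = 1 / (m : ℝ)) (b : Fin n ⊕ Fin m) :
    ∑ x : Fin n × Fin m, p x.1 x.2 * ind b x ≤ 1 / (m : ℝ) := by
  have a2 : (0:ℝ) < m := by exact_mod_cast hm
  have a3 : (m:ℝ) ≤ n := by exact_mod_cast hmn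
  cases b with
  | inl i =>
    have := hr i
    simp only [rowMarg] at this
    simp only [ind, Sum.elim_inl, Fintype.sum_prod_type]
    rw [Finset.sum_eq_single i (by intro j _ hj; simp [hj]) (by simp)]
    simp only [if_true, mul_one]
    rw [this]
    exact one_div_le_one_div_of_le a2 a3
  | inr j =>
    have := hc j
    simp only [colMarg] at this
    simp only [ind, Sum.elim_inr, Fintype.sum_prod_type_right]
    rw [Finset.sum_eq_single j (by intro j _ hj; simp [hj]) (by simp)]
    simp only [if_true, mul_one]
    rw [this]

lemma count_exp {n m : ℕ} (s : ℕ) (p : Matrix (Fin n) (Fin m) ℝ) (hm : 0 < m) (hmn : m ≤ n)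
    (hp : ∀ i j, 0 ≤ p i j) (hp1 : ∑ x : Fin n × Fin m, p x.1 x.2 = 1)
    (hr : ∀ i, rowMarg p i = 1 / (n : ℝ)) (hc : ∀ j, colMarg p j = 1 / (m : ℝ)) (b : Fin n ⊕ Fin m) :
    ∑ S : Fin s → Fin n × Fin m, PP (fun x => p x.1 x.2) S * Real.exp (∑ t, ind b (S t)) ≤
      Real.exp (2 * s / m) := by
  simp only [Real.exp_sum]
  rw [PP_sum_prod (fun x : Fin n × Fin m => p x.1 x.2) (fun x => Real.exp (ind b x))]
  have h1 : ∀ x : Fin n × Fin m, Real.exp (ind b x) ≤ 1 + 2 * ind b x := by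
    intro x
    have he := Real.exp_one_lt_d9
    have : ind b x = 0 ∨ ind b x = 1 := by
      cases b with
      | inl i => by_cases h : x.1 = i <;> simp [ind, h]
      | inr i => by_cases h : x.2 = i <;> simp [ind, h]
    rcases this with h | h <;> rw [h]
    · simp
    · norm_num at he ⊢; linarith
  have h2 : ∑ x : Fin n × Fin m, p x.1 x.2 * Real.exp (ind b x) ≤ Real.exp (2 / m) := by
    calc _ ≤ ∑ x : Fin n × Fin m, p x.1 x.2 * (1 + 2 * ind b x) :=
          Finset.sum_le_sum fun x _ => mul_le_mul_of_nonneg_left (h1 x) (hp _ _)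
      _ = 1 + 2 * ∑ x : Fin n × Fin m, p x.1 x.2 * ind b x := by
          simp only [mul_add, mul_one, Finset.sum_add_distrib]
          rw [hp1, Finset.mul_sum]
          congr 1
          apply Finset.sum_congr rfl; intro x _; ring
      _ ≤ 1 + 2 * (1 / m) := by linarith [sum_ind p hm hmn hr hc b]
      _ ≤ _ := by
          have := Real.add_one_le_exp (2 / (m:ℝ))
          have e : 2 * (1 / (m:ℝ)) = 2 / m := by ring
          linarith
  calc _ ≤ (Real.exp (2 / m)) ^ s := by
        apply pow_le_pow_left₀ _ h2
        exact Finset.sum_nonneg fun x _ => mul_nonneg (hp _ _) (Real.exp_pos _).le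
    _ = _ := by rw [← Real.exp_nat_mul]; congr 1; ring

lemma atomic_smul {n m : ℕ} (R l : ℝ) (hl : 0 ≤ l) (X : Matrix (Fin n) (Fin m) ℝ) (hX : Atomic R X) :
    Atomic (l * R) (l • X) := by
  obtain ⟨σ, w, v, h1, h2, h3, h4, h5⟩ := hX
  refine ⟨fun k => l * σ k, w, v, fun k => mul_nonneg hl (h1 k), ?_, h3, h4, ?_⟩
  · rw [← Finset.mul_sum]; exact mul_le_mul_of_nonneg_left h2 hl
  · intro i j
    rw [Matrix.smul_apply, h5, smul_eq_mul]
    simp only [mul_assoc l, ← Finset.mul_sum]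
    ring

lemma uniform_dev {n m s : ℕ} (r l : ℝ) (p : Matrix (Fin n) (Fin m) ℝ)
    (ℓ : ℝ → ℝ → ℝ) (Y : Matrix (Fin n) (Fin m) ℝ) {K : Type*} [Fintype K] [Nonempty K]
    (X : K → Matrix (Fin n) (Fin m) ℝ) (hX : ∀ a, Atomic (√r) (X a))
    (hm : 2 ≤ m) (hmn : m ≤ n) (hl : 0 ≤ l)
    (hlarge : n * Real.log n ≤ s)
    (hp : ∀ i j, 0 ≤ p i j) (hp1 : ∑ x : Fin n × Fin m, p x.1 x.2 = 1)
    (hr : ∀ i, rowMarg p i = 1 / (n : ℝ)) (hc : ∀ j, colMarg p j = 1 / (m : ℝ))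
    (hlip : LipLoss l ℓ) :
    ∑ S : Fin s → Fin n × Fin m, PP (fun x => p x.1 x.2) S *
      (⨆ a, (s * (∑ x : Fin n × Fin m, p x.1 x.2 * ℓ (X a x.1 x.2) (Y x.1 x.2)) -
        ∑ t, ℓ (X a (S t).1 (S t).2) (Y (S t).1 (S t).2))) ≤
    24 * Real.exp 1 * (√n * √m * (l * √r) * √(s * Real.log n / m)) := by
  have a2 : (2:ℝ) ≤ m := by exact_mod_cast hm
  have a3 : (m:ℝ) ≤ n := by exact_mod_cast hmn
  have hlog2 : (1/2 : ℝ) ≤ Real.log n := by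
    have h1 := Real.log_two_gt_d9
    have h2 : Real.log 2 ≤ Real.log n := Real.log_le_log (by norm_num) (by linarith)
    norm_num at h1; linarith
  have hsm : Real.log n ≤ s / m := by
    rw [le_div_iff₀ (by linarith)]
    nlinarith
  set k : ℕ := ⌈Real.log n⌉₊ with hkdef
  have hk : 0 < k := Nat.ceil_pos.2 (by linarith)
  have hk' : (0:ℝ) < k := by exact_mod_cast hk
  have hk1 : Real.log n ≤ k := Nat.le_ceil _
  have hk2 : (k:ℝ) ≤ 3 * Real.log n := by
    have := Nat.ceil_lt_add_one (show 0 ≤ Real.log n by linarith)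
    linarith
  have hnpos : (0:ℝ) < n := by linarith
  have hkn : (n:ℝ) + m ≤ Real.exp (2 * k) := by
    have h1 : (n:ℝ) ≤ Real.exp k := (Real.log_le_iff_le_exp hnpos).1 hk1
    have h2 : Real.exp (2 * k) = Real.exp k * Real.exp k := by rw [← Real.exp_add]; ring_nf
    rw [h2]
    nlinarith
  set q : Fin n × Fin m → ℝ := fun x => p x.1 x.2 with hq
  have hq0 : ∀ x, 0 ≤ q x := fun x => hp _ _
  have hlog2n : Real.log (2 * n) ≤ 2 * Real.log n := by
    rw [Real.log_mul (by norm_num) (by linarith)]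
    have : Real.log 2 ≤ Real.log n := Real.log_le_log (by norm_num) (by linarith)
    linarith
  have hlog2n0 : 0 < Real.log (2 * n) := Real.log_pos (by linarith)
  have hs0 : (0:ℝ) ≤ s := Nat.cast_nonneg s
  set A : ℝ := 2 * s / m + Real.log (2 * n) with hA
  have hA0 : 0 < A := by positivity
  have hA6 : A + 1 ≤ 6 * (s / m) := by
    have : 2 * (s:ℝ) / m = 2 * (s / m) := by ring
    rw [hA, this]; linarith
  let v : (Fin s → Fin n × Fin m) → ℝ := fun S => A + ∑ b, Real.exp (∑ t, ind b (S t) - A)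
  have hv : ∀ S, 0 < v S := by intro S; simp only [v]; positivity
  have hcount : ∀ S b, ∑ t, ind b (S t) ≤ v S := by
    intro S b
    have h1 := Real.add_one_le_exp (∑ t, ind b (S t) - A)
    have h2 := Finset.single_le_sum (f := fun b => Real.exp (∑ t, ind b (S t) - A))
      (fun b _ => (Real.exp_pos _).le) (Finset.mem_univ b)
    simp only [v]
    linarith
  have hEv : ∑ S : Fin s → Fin n × Fin m, PP q S * v S ≤ A + 1 := by
    simp only [v, mul_add, Finset.sum_add_distrib]
    rw [← Finset.sum_mul, PP_sum q hp1, one_mul]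
    have : ∑ S : Fin s → Fin n × Fin m, PP q S * ∑ b, Real.exp (∑ t, ind b (S t) - A) =
      ∑ b, (∑ S : Fin s → Fin n × Fin m, PP q S * Real.exp (∑ t, ind b (S t))) * Real.exp (-A) := by
      simp only [Finset.mul_sum, Finset.sum_mul]
      rw [Finset.sum_comm]
      apply Finset.sum_congr rfl; intro b _
      apply Finset.sum_congr rfl; intro S _
      rw [sub_eq_add_neg, Real.exp_add]; ring
    rw [this]
    have h3 : ∑ b : Fin n ⊕ Fin m, (∑ S : Fin s → Fin n × Fin m, PP q S * Real.exp (∑ t, ind b (S t))) * Real.exp (-A)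
       ≤ ∑ b : Fin n ⊕ Fin m, Real.exp (2 * s / m) * Real.exp (-A) := by
      apply Finset.sum_le_sum; intro b _
      exact mul_le_mul_of_nonneg_right (count_exp s p (by omega) hmn hp hp1 hr hc b) (Real.exp_pos _).le
    have h4 : Real.exp (2 * s / m) * Real.exp (-A) = 1 / (2 * n) := by
      rw [← Real.exp_add, hA, show 2 * (s:ℝ) / m + -(2 * s / m + Real.log (2 * n)) = - Real.log (2 * n) by ring,
        Real.exp_neg, Real.exp_log (by positivity), one_div]
    rw [h4] at h3
    simp only [Finset.sum_const, Finset.card_univ, Fintype.card_sum, Fintype.card_fin, nsmul_eq_mul] at h3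
    push_cast at h3
    have h5 : ((n:ℝ) + m) * (1 / (2 * n)) ≤ 1 := by
      rw [mul_one_div, div_le_one (by positivity)]; linarith
    linarith
  set β : ℝ := √(2 * k * (A + 1)) with hβ
  have hβ0 : 0 < β := by positivity
  have hβ2 : β ^ 2 = 2 * k * (A + 1) := Real.sq_sqrt (by positivity)
  have hEsq : ∑ S : Fin s → Fin n × Fin m, PP q S * √(2 * k * v S) ≤ β := by
    have h1 : ∀ S, √(2 * k * v S) ≤ (β + 2 * k * v S / β) / 2 := by
      intro S
      have h0 : 0 ≤ 2 * k * v S := by have := hv S; positivity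
      have e := Real.sq_sqrt h0
      have := sq_nonneg (√(2 * k * v S) - β)
      have h2 : β * √(2 * k * v S) ≤ (β ^ 2 + 2 * k * v S) / 2 := by nlinarith
      have h3 : (β + 2 * k * v S / β) / 2 = ((β ^ 2 + 2 * k * v S) / 2) / β := by field_simp
      rw [h3, le_div_iff₀ hβ0]; linarith
    calc _ ≤ ∑ S : Fin s → Fin n × Fin m, PP q S * ((β + 2 * k * v S / β) / 2) :=
          Finset.sum_le_sum fun S _ => mul_le_mul_of_nonneg_left (h1 S) (PP_nonneg q hq0 S)
      _ = (β / 2) * ∑ S : Fin s → Fin n × Fin m, PP q S + (k / β) * ∑ S : Fin s → Fin n × Fin m, PP q S * v S := by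
          rw [Finset.mul_sum, Finset.mul_sum, ← Finset.sum_add_distrib]
          apply Finset.sum_congr rfl; intro S _
          field_simp
      _ ≤ (β / 2) * 1 + (k / β) * (A + 1) := by
          rw [PP_sum q hp1]
          have : 0 ≤ k / β := by positivity
          linarith [mul_le_mul_of_nonneg_left hEv this]
      _ = β := by
          have : (k / β) * (A + 1) = β ^ 2 / (2 * β) := by rw [hβ2]; field_simp
          rw [this]; field_simp; ring
  have hβ3 : β ≤ 6 * √(s * Real.log n / m) := by
    have : (6:ℝ) * √(s * Real.log n / m) = √(36 * (s * Real.log n / m)) := by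
      rw [Real.sqrt_mul (by norm_num), show (36:ℝ) = 6 ^ 2 by norm_num, Real.sqrt_sq (by norm_num)]
    rw [this, hβ]
    apply Real.sqrt_le_sqrt
    have : 2 * k * (A + 1) ≤ 2 * (3 * Real.log n) * (6 * (s / m)) := by
      apply mul_le_mul _ hA6 (by positivity) (by linarith)
      linarith
    refine this.trans (le_of_eq ?_)
    ring
  have hsym := symmetrization (s := s) q hq0 hp1 (fun a x => ℓ (X a x.1 x.2) (Y x.1 x.2))
  have hcon : ∀ S : Fin s → Fin n × Fin m,
      ∑ e : Fin s → Bool, (⨆ a, ∑ t, sgn (e t) * ℓ (X a (S t).1 (S t).2) (Y (S t).1 (S t).2)) ≤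
      2 ^ s * (√n * √m * (l * √r) * (2 * Real.exp 1 * √(2 * k * v S))) := by
    intro S
    have h1 := contraction s (fun _ : K => (0:ℝ))
      (fun t a => ℓ (X a (S t).1 (S t).2) (Y (S t).1 (S t).2))
      (fun t a => (l • X a) (S t).1 (S t).2) (by
        intro t a a'
        simp only [Matrix.smul_apply, smul_eq_mul]
        rw [← mul_sub, abs_mul, abs_of_nonneg hl]
        exact hlip _ _ _)
    simp only [zero_add] at h1
    exact h1.trans (rade_bound S (v S) (l * √r) (by positivity) (hv S) (hcount S) k hk hkn
      (fun a => l • X a) (fun a => atomic_smul _ l hl _ (hX a)))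
  have h2s : (0:ℝ) < 2 ^ s := by positivity
  have hfin : ∑ S : Fin s → Fin n × Fin m, PP q S *
      ∑ e : Fin s → Bool, (⨆ a, ∑ t, sgn (e t) * ℓ (X a (S t).1 (S t).2) (Y (S t).1 (S t).2)) ≤
      2 ^ s * (√n * √m * (l * √r) * (2 * Real.exp 1 * (6 * √(s * Real.log n / m)))) := by
    calc _ ≤ ∑ S : Fin s → Fin n × Fin m, PP q S * (2 ^ s * (√n * √m * (l * √r) * (2 * Real.exp 1 * √(2 * k * v S)))) :=
          Finset.sum_le_sum fun S _ => mul_le_mul_of_nonneg_left (hcon S) (PP_nonneg q hq0 S)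
      _ = 2 ^ s * (√n * √m * (l * √r) * (2 * Real.exp 1 * ∑ S : Fin s → Fin n × Fin m, PP q S * √(2 * k * v S))) := by
          simp only [Finset.mul_sum]
          apply Finset.sum_congr rfl; intro S _; ring
      _ ≤ _ := by
          have := hEsq.trans hβ3
          gcongr
  have h7 := hsym.trans (mul_le_mul_of_nonneg_left hfin (by norm_num))
  have h8 := le_of_mul_le_mul_left (h7.trans (le_of_eq (show _ = 2 ^ s * (24 * Real.exp 1 * (√n * √m * (l * √r) * √(s * Real.log n / m))) by ring))) h2s
  exact h8

/-- Theorem 1, uniform-marginals case: if the sampling distribution has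
uniform row- and column-marginals, any empirical risk minimizer over the `p`-weighted
trace-norm ball satisfies, in expectation over an i.i.d. sample of size `s`,
`E_S[L_p(X̂_S)] ≤ inf_{X ∈ W_p} L_p(X) + C·l·√(r n log n / s)`. -/
theorem weighted_traceNorm_uniform_marginals :
    ∃ C : ℝ, 0 < C ∧
      ∀ (n m s : ℕ) (r l : ℝ) (p : Matrix (Fin n) (Fin m) ℝ)
        (ℓ : ℝ → ℝ → ℝ) (Y : Matrix (Fin n) (Fin m) ℝ)
        (Xhat : (Fin s → Fin n × Fin m) → Matrix (Fin n) (Fin m) ℝ),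
        2 ≤ m → m ≤ n → 1 ≤ r → 0 ≤ l → 1 ≤ s →
        IsDistrib p →
        (∀ i, rowMarg p i = 1 / (n : ℝ)) →
        (∀ j, colMarg p j = 1 / (m : ℝ)) →
        LipLoss l ℓ →
        (∀ S, Xhat S ∈ Wball (rowMarg p) (colMarg p) r ∧
          ∀ X ∈ Wball (rowMarg p) (colMarg p) r,
            empRisk ℓ Y S (Xhat S) ≤ empRisk ℓ Y S X) →
        Esample s p (fun S => popRisk p ℓ Y (Xhat S)) ≤
          sInf ((fun X => popRisk p ℓ Y X) '' Wball (rowMarg p) (colMarg p) r) +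
            C * l * Real.sqrt (r * n * Real.log n / s) := by
  refine ⟨100, by norm_num, ?_⟩
  intro n m s r l p ℓ Y Xhat hm hmn hr1 hl hs hp hr hc hlip hX
  obtain ⟨hp0, hpsum⟩ := hp
  have a2 : (2:ℝ) ≤ m := by exact_mod_cast hm
  have a3 : (m:ℝ) ≤ n := by exact_mod_cast hmn
  have hs1 : (1:ℝ) ≤ s := by exact_mod_cast hs
  have hlog0 : 0 < Real.log n := Real.log_pos (by linarith)
  have hp1 : ∑ x : Fin n × Fin m, p x.1 x.2 = 1 := by
    rw [Fintype.sum_prod_type]; exact hpsum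
  have hpop : ∀ X, popRisk p ℓ Y X = ∑ x : Fin n × Fin m, p x.1 x.2 * ℓ (X x.1 x.2) (Y x.1 x.2) := by
    intro X; rw [Fintype.sum_prod_type]; rfl
  have hat : ∀ X ∈ Wball (rowMarg p) (colMarg p) r, Atomic (√r) X := fun X h =>
    ball_atomic (by omega) (by omega) r _ _ hr hc X h
  have hne : Nonempty (Fin s → Fin n × Fin m) := ⟨fun _ => (⟨0, by omega⟩, ⟨0, by omega⟩)⟩
  set q : Fin n × Fin m → ℝ := fun x => p x.1 x.2 with hq
  have hq0 : ∀ x, 0 ≤ q x := fun x => hp0 _ _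
  have hPS : ∑ S : Fin s → Fin n × Fin m, PP q S = 1 := PP_sum q hp1
  suffices hmain : ∀ X ∈ Wball (rowMarg p) (colMarg p) r,
      Esample s p (fun S => popRisk p ℓ Y (Xhat S)) ≤ popRisk p ℓ Y X +
        100 * l * Real.sqrt (r * n * Real.log n / s) by
    rw [← sub_le_iff_le_add]
    apply le_csInf
    · exact ⟨_, Set.mem_image_of_mem _ (hX hne.some).1⟩
    · rintro _ ⟨X, hXm, rfl⟩
      rw [sub_le_iff_le_add]
      exact hmain X hXm
  intro X hXm
  have hE : Esample s p (fun S => popRisk p ℓ Y (Xhat S)) =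
      ∑ S : Fin s → Fin n × Fin m, PP q S * popRisk p ℓ Y (Xhat S) := rfl
  rw [hE]
  rcases le_total ((n:ℝ) * Real.log n) s with hlarge | hsmall
  · have hdev := uniform_dev (s := s) r l p ℓ Y Xhat (fun S => hat _ (hX S).1) hm hmn hl hlarge hp0 hp1 hr hc hlip
    have h1 : s * ∑ S : Fin s → Fin n × Fin m, PP q S * popRisk p ℓ Y (Xhat S) ≤
        s * popRisk p ℓ Y X + 24 * Real.exp 1 * (√n * √m * (l * √r) * √(s * Real.log n / m)) := by
      have e1 : s * popRisk p ℓ Y X = ∑ S : Fin s → Fin n × Fin m, PP q S *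
          ∑ t, ℓ (X (S t).1 (S t).2) (Y (S t).1 (S t).2) := by
        simp only [Finset.mul_sum]
        rw [Finset.sum_comm]
        have : ∀ t : Fin s, ∑ S : Fin s → Fin n × Fin m, PP q S * ℓ (X (S t).1 (S t).2) (Y (S t).1 (S t).2) =
            popRisk p ℓ Y X := by
          intro t
          rw [hpop]
          exact PP_marg q hp1 (fun x => ℓ (X x.1 x.2) (Y x.1 x.2)) t
        simp [this]
      rw [e1]
      refine le_trans ?_ (add_le_add_right hdev _)
      rw [Finset.mul_sum, ← Finset.sum_add_distrib]
      apply Finset.sum_le_sum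
      intro S _
      rw [← mul_add, mul_left_comm]
      apply mul_le_mul_of_nonneg_left _ (PP_nonneg q hq0 S)
      have h3 := le_fsup (fun a => (s * (∑ x : Fin n × Fin m, p x.1 x.2 * ℓ (Xhat a x.1 x.2) (Y x.1 x.2)) -
        ∑ t, ℓ (Xhat a (S t).1 (S t).2) (Y (S t).1 (S t).2))) S
      rw [← hpop] at h3
      have h4 := (hX S).2 X hXm
      unfold empRisk at h4
      have h5 := le_of_mul_le_mul_left h4 (by positivity)
      linarith
    have h2 : √n * √m * (l * √r) * √(s * Real.log n / m) = s * (l * √(r * n * Real.log n / s)) := by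
      have e1 : √n * √m * √r * √(s * Real.log n / m) = √(n * m * r * (s * Real.log n / m)) := by
        rw [Real.sqrt_mul (by positivity), Real.sqrt_mul (by positivity), Real.sqrt_mul (by positivity)]
      have e2 : (s:ℝ) * √(r * n * Real.log n / s) = √(s ^ 2 * (r * n * Real.log n / s)) := by
        rw [Real.sqrt_mul (by positivity), Real.sqrt_sq (by positivity)]
      have e3 : n * m * r * (s * Real.log n / m) = (s:ℝ) ^ 2 * (r * n * Real.log n / s) := by
        field_simp
      rw [e3] at e1
      linear_combination l * e1 - l * e2
    rw [h2] at h1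
    have h3 : (0:ℝ) < s := by linarith
    have he := Real.exp_one_lt_d9
    have h4 : 24 * Real.exp 1 * (s * (l * √(r * n * Real.log n / s))) ≤ 100 * (s * (l * √(r * n * Real.log n / s))) := by
      apply mul_le_mul_of_nonneg_right _ (by positivity)
      norm_num at he; linarith
    refine le_of_mul_le_mul_left ?_ h3
    linarith
  · have h1 : ∀ S, popRisk p ℓ Y (Xhat S) ≤ popRisk p ℓ Y X + l * (2 * √r) := by
      intro S
      have b1 := atomic_abs (by omega) (by omega) (√r) p hp0 hr hc _ (hat _ (hX S).1)
      have b2 := atomic_abs (by omega) (by omega) (√r) p hp0 hr hc _ (hat _ hXm)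
      have : popRisk p ℓ Y (Xhat S) ≤ popRisk p ℓ Y X + l * (∑ i, ∑ j, p i j * |Xhat S i j| + ∑ i, ∑ j, p i j * |X i j|) := by
        unfold popRisk
        rw [← Finset.sum_add_distrib, Finset.mul_sum, ← Finset.sum_add_distrib]
        apply Finset.sum_le_sum; intro i _
        rw [← Finset.sum_add_distrib, Finset.mul_sum, ← Finset.sum_add_distrib]
        apply Finset.sum_le_sum; intro j _
        have c1 := (le_abs_self _).trans (hlip (Xhat S i j) (X i j) (Y i j))
        have c2 := mul_le_mul_of_nonneg_left (abs_sub (Xhat S i j) (X i j)) hl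
        have c3 := mul_le_mul_of_nonneg_left (c1.trans c2) (hp0 i j)
        linarith
      have := mul_le_mul_of_nonneg_left (add_le_add b1 b2) hl
      linarith
    have h2 : √r ≤ √(r * n * Real.log n / s) := by
      apply Real.sqrt_le_sqrt
      rw [le_div_iff₀ (by linarith)]
      nlinarith
    calc _ ≤ ∑ S : Fin s → Fin n × Fin m, PP q S * (popRisk p ℓ Y X + l * (2 * √r)) :=
          Finset.sum_le_sum fun S _ => mul_le_mul_of_nonneg_left (h1 S) (PP_nonneg q hq0 S)
      _ = popRisk p ℓ Y X + l * (2 * √r) := by rw [← Finset.sum_mul, hPS, one_mul]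
      _ ≤ _ := by
        have := mul_le_mul_of_nonneg_left h2 hl
        have h3 : 0 ≤ l * √(r * n * Real.log n / s) := by positivity
        linarith

end
end

section
/- Suppose the sampling distribution p on [n]×[m] has uniform row- and column-marginals (p^r(i) = 1/n and p^c(j) = 1/m for all i,j) and that s ≥ n·log(n). Then there is an absolute constant C such that the expected empirical Rademacher complexity of the p-weighted trace-norm ball satisfies E_S[R̂_S(W_p)] ≤ C · √(r·n·log(n)/s), where the expectation is over a sample S of size s drawn i.i.d. from p. -/
open scoped Classical
open Matrix Finset

noncomputable section

/-- Empirical Rademacher complexity of a class of matrices on the sample `S`. -/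
def rademacher {n m s : ℕ} (S : Fin s → Fin n × Fin m)
    (𝒳 : Set (Matrix (Fin n) (Fin m) ℝ)) : ℝ :=
  (1 / 2 ^ s) * ∑ σ : Fin s → Bool,
    sSup ((fun X => (1 / (s : ℝ)) *
      ∑ t, (if σ t then (1 : ℝ) else -1) * X (S t).1 (S t).2) '' 𝒳)

def cf {ι : Type} [Fintype ι] [DecidableEq ι] (H A : Matrix ι ι ℝ) : ℕ → ℕ → Matrix ι ι ℝ
  | 0, 0 => 1
  | 0, _ + 1 => 0
  | q + 1, 0 => H * cf H A q 0
  | q + 1, b + 1 => H * cf H A q (b + 1) + A * cf H A q b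

section
variable {ι : Type} [Fintype ι] [DecidableEq ι]

theorem cf_zero (H A : Matrix ι ι ℝ) : ∀ q b, q < b → cf H A q b = 0
  | 0, 0, h => by omega
  | 0, _ + 1, _ => by simp [cf]
  | q + 1, 0, h => by omega
  | q + 1, b + 1, h => by
      simp [cf, cf_zero H A q (b+1) (by omega), cf_zero H A q b (by omega)]

theorem cf_b0 (H A : Matrix ι ι ℝ) (q : ℕ) : cf H A q 0 = H ^ q := by
  induction q with
  | zero => simp [cf]
  | succ q ih => simp [cf, ih, pow_succ']

theorem cf_expand (H A : Matrix ι ι ℝ) (u : ℝ) (q : ℕ) :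
    (H + u • A) ^ q = ∑ b ∈ range (q + 1), u ^ b • cf H A q b := by
  induction q with
  | zero => simp [cf]
  | succ q ih =>
    rw [pow_succ', ih, Finset.sum_range_succ' _ (q+1)]
    simp only [cf, smul_add, Finset.sum_add_distrib, add_mul, Finset.mul_sum]
    have h1 : ∑ b ∈ range (q+1), H * (u ^ b • cf H A q b)
       = ∑ b ∈ range (q+1), u ^ (b+1) • (H * cf H A q (b+1)) + u ^ 0 • (H * cf H A q 0) := by
      rw [← Finset.sum_range_succ' (fun b => u ^ b • (H * cf H A q b)), Finset.sum_range_succ _ (q+1),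
        cf_zero H A q (q+1) (by omega)]
      simp
    rw [h1]
    have h2 : ∑ b ∈ range (q+1), (u • A) * (u ^ b • cf H A q b)
       = ∑ b ∈ range (q+1), u ^ (b+1) • (A * cf H A q b) := by
      refine Finset.sum_congr rfl fun b _ => ?_
      rw [smul_mul_smul_comm, pow_succ']
    rw [h2]; abel

def eA (i j : ι) : Matrix ι ι ℝ := Matrix.single i j 1 + Matrix.single j i 1

theorem eA_entry (X Y : Matrix ι ι ℝ) (i j x y : ι) :
    (X * eA i j * Y) x y = X x i * Y j y + X x j * Y i y := by
  simp [eA, mul_add, add_mul, Matrix.mul_apply, Matrix.single_apply, ite_and, Finset.sum_add_distrib]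

theorem eA_trace (Y : Matrix ι ι ℝ) (i j : ι) :
    (eA i j * Y).trace = Y j i + Y i j := by
  simp [eA, add_mul, Matrix.trace_add, Matrix.trace_single_mul]

theorem entry_bound (H : Matrix ι ι ℝ) (i j : ι) (g : ℝ) (hg0 : 0 ≤ g) (K : ℕ)
    (hg : ∀ a ≤ K, ∀ x y, (x = i ∨ x = j) → (y = i ∨ y = j) → |(H ^ a) x y| ≤ g ^ a) :
    ∀ q b a c h x y, (x = i ∨ x = j) → (y = i ∨ y = j) → a + q + c = h + b → h ≤ K →
      |(H ^ a * cf H (eA i j) q b * H ^ c) x y| ≤ q.choose b * 2 ^ b * g ^ h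
  | 0, 0, a, c, h, x, y, hx, hy, he, hK => by
      have : h = a + c := by omega
      subst this
      simpa [cf, ← pow_add] using hg (a + c) hK x y hx hy
  | 0, b + 1, a, c, h, x, y, hx, hy, he, hK => by simp [cf]
  | q + 1, 0, a, c, h, x, y, hx, hy, he, hK => by
      have := entry_bound H i j g hg0 K hg q 0 (a+1) c h x y hx hy (by omega) hK
      simpa [cf, pow_succ, Matrix.mul_assoc] using this
  | q + 1, b + 1, a, c, h, x, y, hx, hy, he, hK => by
      have h1 := entry_bound H i j g hg0 K hg q (b+1) (a+1) c h x y hx hy (by omega) hK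
      have h2 : |(H ^ a * eA i j * (cf H (eA i j) q b * H ^ c)) x y|
          ≤ q.choose b * 2 ^ (b + 1) * g ^ h := by
        by_cases hqb : q < b
        · rw [cf_zero _ _ _ _ hqb]; simp; positivity
        · obtain ⟨h', hh'⟩ : ∃ h', q + c = h' + b := ⟨q + c - b, by omega⟩
          have e1 := entry_bound H i j g hg0 K hg q b 0 c h' j y (Or.inr rfl) hy (by omega) (by omega)
          have e2 := entry_bound H i j g hg0 K hg q b 0 c h' i y (Or.inl rfl) hy (by omega) (by omega)
          have f1 := hg a (by omega) x i hx (Or.inl rfl)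
          have f2 := hg a (by omega) x j hx (Or.inr rfl)
          simp only [pow_zero, one_mul] at e1 e2
          rw [eA_entry]
          refine (abs_add_le _ _).trans ?_
          rw [abs_mul, abs_mul]
          have hga : (0:ℝ) ≤ g ^ a := by positivity
          have p1 := mul_le_mul f1 e1 (abs_nonneg _) hga
          have p2 := mul_le_mul f2 e2 (abs_nonneg _) hga
          have : h = a + h' := by omega
          subst this
          have e3 : (q.choose b : ℝ) * 2 ^ (b + 1) * g ^ (a + h') = 2 * (g ^ a * (q.choose b * 2 ^ b * g ^ h')) := by
            ring
          linarith
      have h3 : H ^ a * cf H (eA i j) (q+1) (b+1) * H ^ c =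
          H ^ (a+1) * cf H (eA i j) q (b+1) * H ^ c + H ^ a * eA i j * (cf H (eA i j) q b * H ^ c) := by
        simp only [cf, pow_succ, Matrix.mul_assoc, mul_add, add_mul]
      rw [h3, Matrix.add_apply]
      refine (abs_add_le _ _).trans ((add_le_add h1 h2).trans (le_of_eq ?_))
      rw [Nat.choose_succ_succ]; push_cast; ring

theorem trace_bound (H : Matrix ι ι ℝ) (i j : ι) (g : ℝ) (hg0 : 0 ≤ g) (K : ℕ)
    (hg : ∀ a ≤ K, ∀ x y, (x = i ∨ x = j) → (y = i ∨ y = j) → |(H ^ a) x y| ≤ g ^ a)  :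
    ∀ q b c, q + c = K + (b + 1) →
      |(cf H (eA i j) q (b+1) * H ^ c).trace| ≤ q.choose (b+1) * 2 ^ (b+1) * g ^ K
  | 0, b, c, he => by simp [cf]
  | q + 1, b, c, he => by
      have h1 := trace_bound H i j g hg0 K hg q b (c+1) (by omega)
      have e1 := entry_bound H i j g hg0 K hg q b 0 c K j i (Or.inr rfl) (Or.inl rfl) (by omega) le_rfl
      have e2 := entry_bound H i j g hg0 K hg q b 0 c K i j (Or.inl rfl) (Or.inr rfl) (by omega) le_rfl
      simp only [pow_zero, one_mul] at e1 e2
      have h3 : (cf H (eA i j) (q+1) (b+1) * H ^ c).trace =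
          (cf H (eA i j) q (b+1) * H ^ (c+1)).trace + (eA i j * (cf H (eA i j) q b * H ^ c)).trace := by
        simp only [cf, add_mul, Matrix.trace_add, Matrix.mul_assoc]
        rw [Matrix.trace_mul_comm H, Matrix.mul_assoc, pow_succ]
      rw [h3, eA_trace]
      have := abs_add_le ((cf H (eA i j) q b * H ^ c) j i) ((cf H (eA i j) q b * H ^ c) i j)
      refine (abs_add_le _ _).trans ?_
      rw [Nat.choose_succ_succ]; push_cast
      have e3 : ((q.choose b : ℝ) + q.choose b.succ) * 2 ^ (b + 1) * g ^ K = 2 * (q.choose b * 2 ^ b * g ^ K)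
        + q.choose (b + 1) * 2 ^ (b + 1) * g ^ K := by
        rw [Nat.succ_eq_add_one]; ring
      linarith

theorem spectral_aux (H U : Matrix ι ι ℝ) (e : ι → ℝ) (h0 : star U * U = 1) (h0' : U * star U = 1)
    (hs : H = U * diagonal e * star U) (a : ℕ) :
    H ^ a = U * diagonal (fun t => e t ^ a) * star U := by
  induction a with
  | zero => simp [h0']
  | succ a ih =>
    have : (diagonal fun t => e t ^ (a+1)) = diagonal (fun t => e t ^ a) * diagonal e := by
      rw [diagonal_mul_diagonal]; rfl
    rw [pow_succ, ih, this, hs]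
    simp only [Matrix.mul_assoc]
    rw [← Matrix.mul_assoc (star _) U, h0, Matrix.one_mul]

theorem spectral (H : Matrix ι ι ℝ) (hH : H.IsHermitian) :
    ∃ (l : ι → ℝ) (U : Matrix ι ι ℝ), (∀ a x y, (H ^ a) x y = ∑ t, l t ^ a * (U x t * U y t)) ∧
      (∀ t, ∑ x, U x t * U x t = 1) := by
  refine ⟨hH.eigenvalues, (hH.eigenvectorUnitary : Matrix ι ι ℝ), ?_, ?_⟩
  · intro a x y
    have h0 : star (hH.eigenvectorUnitary : Matrix ι ι ℝ) * hH.eigenvectorUnitary = 1 := by simp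
    have h0' : (hH.eigenvectorUnitary : Matrix ι ι ℝ) * star (hH.eigenvectorUnitary : Matrix ι ι ℝ)  = 1 := by simp
    have h1 : H ^ a = hH.eigenvectorUnitary * diagonal (fun t => hH.eigenvalues t ^ a) *
        star (hH.eigenvectorUnitary : Matrix ι ι ℝ) := by
      have hs := hH.spectral_theorem
      simp only [Unitary.conjStarAlgAut_apply] at hs
      exact spectral_aux H _ _ h0 h0' hs a
    rw [h1, Matrix.mul_apply]
    refine Finset.sum_congr rfl fun t _ => ?_
    rw [Matrix.mul_diagonal, Matrix.star_apply, star_trivial]; ring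
  · intro t
    have h0 : star (hH.eigenvectorUnitary : Matrix ι ι ℝ) * hH.eigenvectorUnitary = 1 := by simp
    have := congrFun (congrFun h0 t) t
    simpa [Matrix.mul_apply, Matrix.star_apply] using this

theorem exists_g (H : Matrix ι ι ℝ) (hH : H.IsHermitian) (i j : ι) (K : ℕ) (hK : Even K) :
    ∃ g : ℝ, 0 ≤ g ∧ g ^ K ≤ (H ^ K) i i + (H ^ K) j j ∧
      ∀ a ≤ K, ∀ x y, (x = i ∨ x = j) → (y = i ∨ y = j) → |(H ^ a) x y| ≤ g ^ a := by
  obtain ⟨l, U, h1, h2⟩ := spectral H hH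
  have hd : ∀ x, 0 ≤ (H ^ K) x x := fun x => by
    rw [h1]; exact Finset.sum_nonneg fun t _ => mul_nonneg (hK.pow_nonneg _) (mul_self_nonneg _)
  rcases Nat.eq_zero_or_pos K with rfl | hKpos
  · refine ⟨1, zero_le_one, by simp, ?_⟩
    intro a ha x y _ _
    have : a = 0 := by omega
    subst this
    by_cases hxy : x = y <;> simp [hxy]
  set B := (H ^ K) i i + (H ^ K) j j with hB
  have hB0 : 0 ≤ B := add_nonneg (hd i) (hd j)
  have hK' : (K : ℝ) ≠ 0 := by positivity
  refine ⟨B ^ (1 / (K : ℝ)), by positivity, ?_, ?_⟩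
  · rw [← Real.rpow_natCast, ← Real.rpow_mul hB0, one_div_mul_cancel hK', Real.rpow_one]
  intro a ha x y hx hy
  have hsum : ∀ x, ∑ t, U x t * U x t = 1 := fun x => by
    have := h1 0 x x
    simpa using this.symm
  set w : ι → ℝ := fun t => (U x t * U x t + U y t * U y t) / 2 with hw
  have hw0 : ∀ t, 0 ≤ w t := fun t => by
    have := mul_self_nonneg (U x t); have := mul_self_nonneg (U y t); simp only [hw]; linarith
  have hw1 : ∑ t, w t = 1 := by
    simp only [hw]; rw [← Finset.sum_div, Finset.sum_add_distrib, hsum, hsum]; norm_num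
  have hle : |(H ^ a) x y| ≤ ∑ t, w t * |l t| ^ a := by
    rw [h1]
    refine (Finset.abs_sum_le_sum_abs _ _).trans (Finset.sum_le_sum fun t _ => ?_)
    rw [abs_mul, abs_pow, mul_comm]
    refine mul_le_mul_of_nonneg_right ?_ (by positivity)
    rw [abs_le]; simp only [hw]
    constructor <;> nlinarith [sq_nonneg (U x t + U y t), sq_nonneg (U x t - U y t)]
  rcases Nat.eq_zero_or_pos a with rfl | hapos
  · simpa [hw1] using hle
  have ha' : (0 : ℝ) < a := by exact_mod_cast hapos
  have hj := Real.rpow_arith_mean_le_arith_mean_rpow univ w (fun t => |l t| ^ a) (fun t _ => hw0 t) hw1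
    (fun t _ => by positivity) (p := (K : ℝ) / a) (by rw [le_div_iff₀ ha']; simpa using ha)
  have hr : ∑ t, w t * (|l t| ^ a) ^ ((K : ℝ) / a) ≤ B := by
    have e : ∑ t, w t * (|l t| ^ a) ^ ((K : ℝ) / a) = ((H ^ K) x x + (H ^ K) y y) / 2 := by
      rw [h1, h1, ← Finset.sum_add_distrib, Finset.sum_div]
      refine Finset.sum_congr rfl fun t _ => ?_
      rw [← Real.rpow_natCast, ← Real.rpow_mul (abs_nonneg _), mul_div_cancel₀ _ ha'.ne', Real.rpow_natCast,
        hK.pow_abs]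
      simp only [hw]; ring
    rw [e]
    have := hd i; have := hd j
    rcases hx with rfl | rfl <;> rcases hy with rfl | rfl <;> simp only [hB] <;> linarith
  have hs0 : 0 ≤ ∑ t, w t * |l t| ^ a :=
    Finset.sum_nonneg fun t _ => mul_nonneg (hw0 t) (by positivity)
  refine hle.trans ?_
  have := Real.rpow_le_rpow (by positivity) (hj.trans hr) (z := (a : ℝ) / K) (by positivity)
  rw [← Real.rpow_mul hs0, div_mul_div_cancel₀ ha'.ne', div_self hK', Real.rpow_one] at this
  refine this.trans (le_of_eq ?_)
  rw [← Real.rpow_natCast, ← Real.rpow_mul hB0]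
  congr 1; ring

theorem diag_nonneg (H : Matrix ι ι ℝ) (hH : H.IsHermitian) (K : ℕ) (hK : Even K) (x : ι) :
    0 ≤ (H ^ K) x x := by
  obtain ⟨l, U, h1, h2⟩ := spectral H hH
  rw [h1]; exact Finset.sum_nonneg fun t _ => mul_nonneg (hK.pow_nonneg _) (mul_self_nonneg _)

theorem coef_bound (H : Matrix ι ι ℝ) (hH : H.IsHermitian) (i j : ι) (k l : ℕ) (hl : l < k) :
    (cf H (eA i j) (2 * k) (2 * (l + 1))).trace ≤
      (2 * k).choose (2 * (l + 1)) * 4 ^ (l + 1) * ((H ^ (2 * (k - (l + 1)))) i i + (H ^ (2 * (k - (l + 1)))) j j) := by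
  obtain ⟨g, hg0, hgK, hg⟩ := exists_g H hH i j (2 * (k - (l + 1))) (even_two_mul _)
  have := trace_bound H i j g hg0 _ hg (2 * k) (2 * l + 1) 0 (by omega)
  rw [pow_zero, Matrix.mul_one] at this
  refine (le_abs_self _).trans (this.trans ?_)
  have e : (2:ℝ) ^ (2 * l + 1 + 1) = 4 ^ (l + 1) := by
    rw [show 2 * l + 1 + 1 = 2 * (l + 1) by ring, pow_mul]; norm_num
  rw [e]
  exact mul_le_mul_of_nonneg_left hgK (by positivity)

theorem sum_even_odd (f : ℕ → ℝ) (k : ℕ) :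
    ∑ b ∈ range (2 * k + 1), (1 ^ b * f b + (-1) ^ b * f b) = 2 * ∑ l ∈ range (k + 1), f (2 * l) := by
  induction k with
  | zero => simp; ring
  | succ k ih =>
    rw [show 2 * (k + 1) + 1 = 2 * k + 1 + 1 + 1 by ring, Finset.sum_range_succ, Finset.sum_range_succ, ih,
      Finset.sum_range_succ _ (k + 1), show 2 * (k + 1) = 2 * k + 1 + 1 by ring]
    have h : (-1 : ℝ) ^ (2 * k) = 1 := by simp [pow_mul]
    simp only [pow_succ, h, one_pow]; ring

/-- one-step inequality -/
theorem one_step (H : Matrix ι ι ℝ) (hH : H.IsHermitian) (i j : ι) (k : ℕ) :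
    (1 / 2 : ℝ) * (((H + (1 : ℝ) • eA i j) ^ (2 * k)).trace + ((H + (-1 : ℝ) • eA i j) ^ (2 * k)).trace) ≤
      (H ^ (2 * k)).trace + ∑ l ∈ range k, (2 * k).choose (2 * (l + 1)) * 4 ^ (l + 1) *
        ((H ^ (2 * (k - (l + 1)))) i i + (H ^ (2 * (k - (l + 1)))) j j) := by
  rw [cf_expand, cf_expand]
  simp only [Matrix.trace_sum, Matrix.trace_smul, smul_eq_mul]
  rw [← Finset.sum_add_distrib, sum_even_odd (fun b => (cf H (eA i j) (2 * k) b).trace),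
    Finset.sum_range_succ', mul_zero, cf_b0]
  have : ∑ l ∈ range k, (cf H (eA i j) (2 * k) (2 * (l + 1))).trace ≤
    ∑ l ∈ range k, ((2 * k).choose (2 * (l + 1)) : ℝ) * 4 ^ (l + 1) *
        ((H ^ (2 * (k - (l + 1)))) i i + (H ^ (2 * (k - (l + 1)))) j j) :=
    Finset.sum_le_sum fun l hl => coef_bound H hH i j k l (Finset.mem_range.1 hl)
  linarith

end
theorem sum_fcons {α : Type} [Fintype α] (s : ℕ) (F : (Fin (s + 1) → α) → ℝ) :
    ∑ S, F S = ∑ S : Fin s → α, ∑ x, F (Fin.cons x S) := by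
  rw [← (Fin.consEquiv (fun _ : Fin (s+1) => α)).sum_comp F, Fintype.sum_prod_type, Finset.sum_comm]
  rfl

def HH {n m s : ℕ} (S : Fin s → Fin n × Fin m) (σ : Fin s → Bool) :
    Matrix (Fin n ⊕ Fin m) (Fin n ⊕ Fin m) ℝ :=
  ∑ t, (if σ t then (1 : ℝ) else -1) • eA (Sum.inl (S t).1) (Sum.inr (S t).2)

def EE {n m : ℕ} (s : ℕ) (p : Matrix (Fin n) (Fin m) ℝ)
    (f : (Fin s → Fin n × Fin m) → (Fin s → Bool) → ℝ) : ℝ :=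
  ∑ S, ∑ σ, (sampleProb p S * (1 / 2 ^ s)) * f S σ

theorem eA_herm {ι : Type} [Fintype ι] [DecidableEq ι] (i j : ι) : (eA i j).IsHermitian := by
  unfold eA Matrix.IsHermitian
  simp [add_comm]

theorem HH_herm {n m s : ℕ} (S : Fin s → Fin n × Fin m) (σ : Fin s → Bool) :
    (HH S σ).IsHermitian := by
  unfold HH Matrix.IsHermitian
  rw [Matrix.conjTranspose_sum]
  refine Finset.sum_congr rfl fun t _ => ?_
  rw [Matrix.conjTranspose_smul, (eA_herm _ _).eq, star_trivial]

theorem sampleProb_nonneg {n m s : ℕ} {p : Matrix (Fin n) (Fin m) ℝ} (hp : IsDistrib p)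
    (S : Fin s → Fin n × Fin m) : 0 ≤ sampleProb p S :=
  Finset.prod_nonneg fun _ _ => hp.1 _ _

theorem EE_mono {n m s : ℕ} {p : Matrix (Fin n) (Fin m) ℝ} (hp : IsDistrib p)
    {f g : (Fin s → Fin n × Fin m) → (Fin s → Bool) → ℝ} (h : ∀ S σ, f S σ ≤ g S σ) :
    EE s p f ≤ EE s p g :=
  Finset.sum_le_sum fun S _ => Finset.sum_le_sum fun σ _ =>
    mul_le_mul_of_nonneg_left (h S σ) (mul_nonneg (sampleProb_nonneg hp S) (by positivity))

theorem EE_succ {n m s : ℕ} (p : Matrix (Fin n) (Fin m) ℝ)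
    (f : Matrix (Fin n ⊕ Fin m) (Fin n ⊕ Fin m) ℝ → ℝ) :
    EE (s + 1) p (fun S σ => f (HH S σ)) = EE s p (fun S σ => ∑ i, ∑ j, p i j *
      ((1 / 2 : ℝ) * (f (HH S σ + (1 : ℝ) • eA (Sum.inl i) (Sum.inr j)) +
        f (HH S σ + (-1 : ℝ) • eA (Sum.inl i) (Sum.inr j))))) := by
  unfold EE
  rw [sum_fcons]
  refine Finset.sum_congr rfl fun S _ => ?_
  rw [Finset.sum_congr rfl fun x _ => sum_fcons s _, Finset.sum_comm]
  refine Finset.sum_congr rfl fun σ _ => ?_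
  rw [Fintype.sum_prod_type, Finset.mul_sum]
  refine Finset.sum_congr rfl fun i _ => ?_
  rw [Finset.mul_sum]
  refine Finset.sum_congr rfl fun j _ => ?_
  simp only [Fintype.sum_bool, HH, Fin.sum_univ_succ, Fin.cons_zero, Fin.cons_succ, sampleProb,
    Fin.prod_univ_succ, if_true, Bool.false_eq_true, if_false]
  rw [add_comm ((1 : ℝ) • _) (∑ _, _), add_comm ((-1 : ℝ) • _) (∑ _, _), pow_succ]
  field_simp

theorem EE_const {n m s : ℕ} {p : Matrix (Fin n) (Fin m) ℝ} (hp : IsDistrib p) (c : ℝ) :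
    EE s p (fun _ _ => c) = c := by
  induction s with
  | zero => simp [EE, sampleProb]
  | succ s ih =>
    have := EE_succ (s := s) p (fun _ => c)
    rw [this]
    have h2 : ∑ i, ∑ j, p i j * ((1 / 2 : ℝ) * (c + c)) = c := by
      simp only [← Finset.sum_mul]; rw [hp.2]; ring
    rw [h2, ih]

theorem EE_add {n m s : ℕ} (p : Matrix (Fin n) (Fin m) ℝ)
    (f g : (Fin s → Fin n × Fin m) → (Fin s → Bool) → ℝ) :
    EE s p (fun S σ => f S σ + g S σ) = EE s p f + EE s p g := by
  simp only [EE, mul_add, Finset.sum_add_distrib]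

theorem EE_mul {n m s : ℕ} (p : Matrix (Fin n) (Fin m) ℝ) (c : ℝ)
    (f : (Fin s → Fin n × Fin m) → (Fin s → Bool) → ℝ) :
    EE s p (fun S σ => c * f S σ) = c * EE s p f := by
  simp only [EE, Finset.mul_sum]
  refine Finset.sum_congr rfl fun S _ => Finset.sum_congr rfl fun σ _ => by ring

theorem EE_sum {n m s : ℕ} (p : Matrix (Fin n) (Fin m) ℝ) (k : ℕ)
    (f : ℕ → (Fin s → Fin n × Fin m) → (Fin s → Bool) → ℝ) :
    EE s p (fun S σ => ∑ l ∈ range k, f l S σ) = ∑ l ∈ range k, EE s p (f l) := by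
  induction k with
  | zero => simp [EE]
  | succ k ih => simp only [Finset.sum_range_succ]; rw [EE_add, ih]

theorem avg_step {n m : ℕ} {p : Matrix (Fin n) (Fin m) ℝ} (hp : IsDistrib p) (hm : 1 ≤ m) (hmn : m ≤ n)
    (hr : ∀ i, rowMarg p i = 1 / (n : ℝ)) (hc : ∀ j, colMarg p j = 1 / (m : ℝ))
    (H : Matrix (Fin n ⊕ Fin m) (Fin n ⊕ Fin m) ℝ) (hH : H.IsHermitian) (k : ℕ) :
    ∑ i, ∑ j, p i j * ((1 / 2 : ℝ) * (((H + (1 : ℝ) • eA (Sum.inl i) (Sum.inr j)) ^ (2 * k)).trace +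
        ((H + (-1 : ℝ) • eA (Sum.inl i) (Sum.inr j)) ^ (2 * k)).trace)) ≤
      (H ^ (2 * k)).trace + ∑ l ∈ range k, ((2 * k).choose (2 * (l + 1)) * 4 ^ (l + 1) * (1 / m : ℝ)) *
        (H ^ (2 * (k - (l + 1)))).trace := by
  have key : ∀ K, Even K → ∑ i, ∑ j, p i j * ((H ^ K) (Sum.inl i) (Sum.inl i) + (H ^ K) (Sum.inr j) (Sum.inr j))
      ≤ (1 / m : ℝ) * (H ^ K).trace := by
    intro K hK
    have e1 : ∑ i, ∑ j, p i j * (H ^ K) (Sum.inl i) (Sum.inl i) =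
        (1 / n : ℝ) * ∑ i : Fin n, (H ^ K) (Sum.inl i) (Sum.inl i) := by
      rw [Finset.mul_sum]
      refine Finset.sum_congr rfl fun i _ => ?_
      rw [← Finset.sum_mul, ← hr i]; rfl
    have e2 : ∑ i, ∑ j, p i j * (H ^ K) (Sum.inr j) (Sum.inr j) =
        (1 / m : ℝ) * ∑ i : Fin m, (H ^ K) (Sum.inr i) (Sum.inr i) := by
      rw [Finset.mul_sum, Finset.sum_comm]
      refine Finset.sum_congr rfl fun i _ => ?_
      rw [← Finset.sum_mul, ← hc i]; rfl
    simp only [mul_add, Finset.sum_add_distrib]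
    rw [e1, e2, Matrix.trace, Fintype.sum_sum_type, mul_add]
    have h0 : 0 ≤ ∑ i : Fin n, (H ^ K) (Sum.inl i) (Sum.inl i) :=
      Finset.sum_nonneg fun i _ => diag_nonneg H hH K hK _
    have h1 : (1 / n : ℝ) ≤ 1 / m := by
      have : (0:ℝ) < m := by exact_mod_cast hm
      exact one_div_le_one_div_of_le this (by exact_mod_cast hmn)
    have := mul_le_mul_of_nonneg_right h1 h0
    simpa [Matrix.diag] using this
  calc _ ≤ ∑ i, ∑ j, p i j * ((H ^ (2 * k)).trace + ∑ l ∈ range k, (2 * k).choose (2 * (l + 1)) * 4 ^ (l + 1) *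
        ((H ^ (2 * (k - (l + 1)))) (Sum.inl i) (Sum.inl i) + (H ^ (2 * (k - (l + 1)))) (Sum.inr j) (Sum.inr j))) :=
        Finset.sum_le_sum fun i _ => Finset.sum_le_sum fun j _ =>
          mul_le_mul_of_nonneg_left (one_step H hH _ _ k) (hp.1 i j)
    _ = (H ^ (2 * k)).trace + ∑ l ∈ range k, ((2 * k).choose (2 * (l + 1)) * 4 ^ (l + 1)) *
        ∑ i, ∑ j, p i j * ((H ^ (2 * (k - (l + 1)))) (Sum.inl i) (Sum.inl i) + (H ^ (2 * (k - (l + 1)))) (Sum.inr j) (Sum.inr j)) := by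
        simp only [mul_add (p _ _) (trace _) _, Finset.sum_add_distrib, ← Finset.sum_mul, hp.2, one_mul]
        congr 1
        simp only [Finset.mul_sum]
        rw [Finset.sum_congr rfl fun i _ => Finset.sum_comm, Finset.sum_comm]
        refine Finset.sum_congr rfl fun l _ => Finset.sum_congr rfl fun i _ => Finset.sum_congr rfl fun j _ => by ring
    _ ≤ _ := by
        refine add_le_add le_rfl (Finset.sum_le_sum fun l hl => ?_)
        rw [mul_assoc _ (1 / m : ℝ)]
        exact mul_le_mul_of_nonneg_left (key _ (even_two_mul _)) (by positivity)

theorem series_bound (z : ℝ) (hz : 0 < z) (hz1 : z ≤ 1) (k : ℕ) :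
    ∑ l ∈ range k, z ^ (l + 1) / (2 * (l + 1)).factorial ≤ z := by
  have h1 : ∀ k, ∑ l ∈ range k, z ^ (l + 1) / (2 * (l + 1)).factorial ≤ z * (1 - (1 / 2) ^ k) := by
    intro k
    induction k with
    | zero => simp
    | succ k ih =>
      rw [Finset.sum_range_succ]
      have h2 : z ^ (k + 1) / (2 * (k + 1)).factorial ≤ z * (1 / 2) ^ (k + 1) := by
        have h3 : z ^ (k + 1) ≤ z := by
          rw [pow_succ]; exact mul_le_of_le_one_left hz.le (pow_le_one₀ hz.le hz1)
        have h4 : (2 : ℝ) ^ (k + 1) ≤ (2 * (k + 1)).factorial := by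
          have : ∀ k : ℕ, 2 ^ (k + 1) ≤ (2 * (k + 1)).factorial := by
            intro k
            induction k with
            | zero => decide
            | succ k ih =>
              rw [show 2 * (k + 1 + 1) = 2 * (k + 1) + 1 + 1 by ring, Nat.factorial_succ, Nat.factorial_succ, pow_succ]
              calc 2 ^ (k + 1) * 2 ≤ (2 * (k + 1)).factorial * 2 := by omega
                _ ≤ (2 * (k + 1)).factorial * ((2 * (k + 1) + 1 + 1) * (2 * (k + 1) + 1)) :=
                  Nat.mul_le_mul_left _ (by nlinarith)
                _ = _ := by ring
          exact_mod_cast this k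
        rw [one_div, inv_pow, ← div_eq_mul_inv]
        gcongr
      have h5 : ((1:ℝ) / 2) ^ (k + 1) = (1 / 2) ^ k * (1 / 2) := pow_succ _ _
      rw [h5] at h2 ⊢
      linarith
  refine (h1 k).trans ?_
  have : (0:ℝ) < (1 / 2) ^ k := by positivity
  nlinarith

theorem moment {n m : ℕ} {p : Matrix (Fin n) (Fin m) ℝ} (hp : IsDistrib p) (hm : 1 ≤ m) (hmn : m ≤ n)
    (hr : ∀ i, rowMarg p i = 1 / (n : ℝ)) (hc : ∀ j, colMarg p j = 1 / (m : ℝ))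
    (z : ℝ) (hz : 0 < z) (hz1 : z ≤ 1) (s : ℕ) : ∀ k : ℕ,
    EE s p (fun S σ => (HH S σ ^ (2 * k)).trace) ≤
      ((n : ℝ) + m) * (2 * k).factorial * (4 / z) ^ k * (1 + z / m) ^ s := by
  induction s with
  | zero =>
    intro k
    rcases k with _ | k
    · simp [EE, sampleProb]
    · have : EE 0 p (fun S σ => (HH S σ ^ (2 * (k+1))).trace) = 0 := by
        simp [EE, HH]
      rw [this]; positivity
  | succ s ih =>
    intro k
    rw [EE_succ p (fun H => (H ^ (2 * k)).trace)]
    refine (EE_mono hp fun S σ => avg_step hp hm hmn hr hc (HH S σ) (HH_herm S σ) k).trans ?_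
    rw [EE_add, EE_sum]
    simp only [EE_mul]
    set N : ℝ := (n : ℝ) + m
    have hm0 : (0:ℝ) < m := by exact_mod_cast hm
    have h1 : ∀ l ∈ range k, ((2 * k).choose (2 * (l + 1)) * 4 ^ (l + 1) * (1 / m : ℝ)) *
        EE s p (fun S σ => (HH S σ ^ (2 * (k - (l + 1)))).trace) ≤
        (N * (2 * k).factorial * (4 / z) ^ k * (1 + z / m) ^ s * (1 / m)) *
          (z ^ (l + 1) / (2 * (l + 1)).factorial) := by
      intro l hl
      have hl := Finset.mem_range.1 hl
      refine (mul_le_mul_of_nonneg_left (ih _) (by positivity)).trans (le_of_eq ?_)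
      obtain ⟨d, rfl⟩ : ∃ d, k = d + (l + 1) := ⟨k - (l + 1), by omega⟩
      have hch := Nat.add_choose_mul_factorial_mul_factorial (2 * d) (2 * (l + 1))
      rw [← mul_add] at hch
      have hch' : (((2 * (d + (l + 1))).choose (2 * (l+1)) : ℕ) : ℝ) * (2 * d).factorial * (2 * (l + 1)).factorial
         = (2 * (d + (l + 1))).factorial := by
        rw [← hch]; push_cast
        rw [show (2 * (d + (l + 1))).choose (2 * (l+1)) = (2 * (d + (l + 1))).choose (2 * d) from
          Nat.choose_symm_of_eq_add (by ring)]
      rw [Nat.add_sub_cancel, ← hch']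
      have hf : ((2 * (l + 1)).factorial : ℝ) ≠ 0 := by positivity
      rw [pow_add (4 / z) d (l+1), div_pow 4 z (l+1)]
      field_simp
    refine (add_le_add (ih k) (Finset.sum_le_sum h1)).trans ?_
    rw [← Finset.mul_sum]
    have h2 := series_bound z hz hz1 k
    refine (add_le_add_right (mul_le_mul_of_nonneg_left h2 (by positivity)) _).trans (le_of_eq ?_)
    rw [pow_succ]; ring
theorem dual_bound {n m : ℕ} (Q Y : Matrix (Fin n) (Fin m) ℝ) (B : ℝ) (hB : 0 ≤ B)
    (hQ : ∀ v : Fin m → ℝ, ∑ i, (Q *ᵥ v) i ^ 2 ≤ B ^ 2 * ∑ j, v j ^ 2) :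
    ∑ i, ∑ j, Q i j * Y i j ≤ B * traceNorm Y := by
  set hY := Matrix.isHermitian_conjTranspose_mul_self Y with hYdef
  have h0 : star (hY.eigenvectorUnitary : Matrix (Fin m) (Fin m) ℝ) * hY.eigenvectorUnitary = 1 := by simp
  have h0' : (hY.eigenvectorUnitary : Matrix (Fin m) (Fin m) ℝ) * star (hY.eigenvectorUnitary : Matrix (Fin m) (Fin m) ℝ)
      = 1 := by simp
  have hs := hY.spectral_theorem
  simp only [Unitary.conjStarAlgAut_apply] at hs
  set V : Matrix (Fin m) (Fin m) ℝ := (hY.eigenvectorUnitary : Matrix (Fin m) (Fin m) ℝ) with hV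
  have hst : star V = Vᵀ := by ext; simp [Matrix.star_apply]
  rw [hst] at h0 h0' hs
  have hct : Yᴴ = Yᵀ := by ext; simp
  have e1 : ∑ i, ∑ j, Q i j * Y i j = ∑ t, ∑ i, (Q * V) i t * (Y * V) i t := by
    have a1 : ∑ i, ∑ j, Q i j * Y i j = (Q * Yᵀ).trace := by
      simp [Matrix.trace, Matrix.mul_apply]
    have a2 : ∑ t, ∑ i, (Q * V) i t * (Y * V) i t = ((Q * V) * (Y * V)ᵀ).trace := by
      rw [Finset.sum_comm]
      simp only [Matrix.trace, Matrix.diag, Matrix.mul_apply (M := Q * V), Matrix.transpose_apply]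
    rw [a1, a2, Matrix.transpose_mul, Matrix.mul_assoc, ← Matrix.mul_assoc V, h0', Matrix.one_mul]
  have e2 : ∀ t, ∑ i, (Y * V) i t ^ 2 = hY.eigenvalues t := by
    intro t
    have a1 : (Y * V)ᵀ * (Y * V) = diagonal hY.eigenvalues := by
      have : (Y * V)ᵀ * (Y * V) = Vᵀ * (Yᴴ * Y) * V := by
        rw [Matrix.transpose_mul, hct]; simp only [Matrix.mul_assoc]
      rw [this]
      have a3 : Vᵀ * (V * diagonal (RCLike.ofReal ∘ hY.eigenvalues) * Vᵀ) * V = diagonal hY.eigenvalues := by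
        calc _ = (Vᵀ * V) * diagonal (RCLike.ofReal ∘ hY.eigenvalues) * (Vᵀ * V) := by
              simp only [Matrix.mul_assoc]
          _ = _ := by rw [h0, Matrix.one_mul, Matrix.mul_one]; rfl
      rw [← a3]
      exact congrArg (fun M => Vᵀ * M * V) hs
    have := congrFun (congrFun a1 t) t
    rw [Matrix.mul_apply, diagonal_apply_eq] at this
    rw [← this]
    exact Finset.sum_congr rfl fun i _ => by rw [Matrix.transpose_apply, sq]
  have e3 : ∀ t, ∑ i, (Q * V) i t ^ 2 ≤ B ^ 2 := by
    intro t
    have := hQ (fun j => V j t)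
    have a1 : ∑ j, V j t ^ 2 = 1 := by
      have := congrFun (congrFun h0 t) t
      rw [Matrix.mul_apply, Matrix.one_apply_eq] at this
      rw [← this]
      exact Finset.sum_congr rfl fun i _ => by rw [Matrix.transpose_apply, sq]
    rw [a1, mul_one] at this
    exact this
  rw [e1, traceNorm, Finset.mul_sum]
  refine Finset.sum_le_sum fun t _ => ?_
  refine (Real.sum_mul_le_sqrt_mul_sqrt _ _ _).trans ?_
  rw [e2 t]
  refine mul_le_mul_of_nonneg_right ?_ (Real.sqrt_nonneg _)
  exact (Real.sqrt_le_sqrt (e3 t)).trans (by rw [Real.sqrt_sq hB])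

theorem op_bound {ι : Type} [Fintype ι] [DecidableEq ι] (H : Matrix ι ι ℝ) (hH : H.IsHermitian)
    (k : ℕ) (hk : 1 ≤ k) (B : ℝ) (hB : 0 ≤ B) (hBk : (H ^ (2 * k)).trace ≤ B ^ (2 * k)) (w : ι → ℝ) :
    ∑ x, (H *ᵥ w) x ^ 2 ≤ B ^ 2 * ∑ x, w x ^ 2 := by
  obtain ⟨l, U, h1, h2⟩ := spectral H hH
  have quad : ∀ a, ∑ x, ∑ y, w x * ((H ^ a) x y * w y) = ∑ t, l t ^ a * (∑ x, U x t * w x) ^ 2 := by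
    intro a
    simp only [h1, sq, Finset.sum_mul_sum, Finset.mul_sum, Finset.sum_mul]
    rw [Finset.sum_congr rfl fun x _ => Finset.sum_comm, Finset.sum_comm]
    refine Finset.sum_congr rfl fun t _ => Finset.sum_congr rfl fun x _ => Finset.sum_congr rfl fun y _ => by ring
  have htr : (H ^ (2 * k)).trace = ∑ t, l t ^ (2 * k) := by
    simp only [Matrix.trace, Matrix.diag, h1]
    rw [Finset.sum_comm]
    refine Finset.sum_congr rfl fun t _ => ?_
    rw [← Finset.mul_sum, h2, mul_one]
  have hl : ∀ t, l t ^ 2 ≤ B ^ 2 := by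
    intro t
    have : l t ^ (2 * k) ≤ B ^ (2 * k) := by
      refine le_trans ?_ hBk
      rw [htr]
      exact Finset.single_le_sum (f := fun t => l t ^ (2 * k))
        (fun t _ => (even_two_mul k).pow_nonneg _) (Finset.mem_univ t)
    rw [pow_mul, pow_mul] at this
    exact (pow_le_pow_iff_left₀ (sq_nonneg _) (sq_nonneg _) (by omega)).1 this
  have e1 : ∑ x, (H *ᵥ w) x ^ 2 = ∑ x, ∑ y, w x * ((H ^ 2) x y * w y) := by
    have hT : Hᵀ = H := by
      have := hH.eq; rwa [Matrix.conjTranspose_eq_transpose_of_trivial] at this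
    have a1 : ∑ x, (H *ᵥ w) x ^ 2 = (H *ᵥ w) ⬝ᵥ (H *ᵥ w) := by simp [dotProduct, sq]
    have a2 : ∑ x, ∑ y, w x * ((H ^ 2) x y * w y) = w ⬝ᵥ (H ^ 2 *ᵥ w) := by
      simp [dotProduct, Matrix.mulVec, Finset.mul_sum]
    rw [a1, a2, sq, ← Matrix.mulVec_mulVec, Matrix.dotProduct_mulVec w H, ← Matrix.mulVec_transpose, hT]
  have e0 : ∑ x, w x ^ 2 = ∑ x, ∑ y, w x * ((H ^ 0) x y * w y) := by
    simp [Matrix.one_apply, sq]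
  rw [e1, e0, quad, quad, Finset.mul_sum]
  refine Finset.sum_le_sum fun t _ => ?_
  rw [pow_zero, one_mul]
  exact mul_le_mul_of_nonneg_right (hl t) (sq_nonneg _)

theorem sup_bound {n m s : ℕ} (hn : 1 ≤ n) (hm : 1 ≤ m) (r : ℝ) (pr : Fin n → ℝ) (pc : Fin m → ℝ)
    (hr : ∀ i, pr i = 1 / (n : ℝ)) (hc : ∀ j, pc j = 1 / (m : ℝ))
    (S : Fin s → Fin n × Fin m) (σ : Fin s → Bool) (k : ℕ) (hk : 1 ≤ k) (B : ℝ) (hB : 0 ≤ B)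
    (hBk : (HH S σ ^ (2 * k)).trace ≤ B ^ (2 * k)) :
    sSup ((fun X : Matrix (Fin n) (Fin m) ℝ => (1 / (s : ℝ)) *
      ∑ t, (if σ t then (1 : ℝ) else -1) * X (S t).1 (S t).2) '' Wball pr pc r) ≤
      (1 / (s : ℝ)) * (Real.sqrt n * Real.sqrt m * Real.sqrt r) * B := by
  refine Real.sSup_le ?_ (by positivity)
  rintro _ ⟨X, hX, rfl⟩
  simp only
  rw [mul_assoc (1 / (s : ℝ))]
  refine mul_le_mul_of_nonneg_left ?_ (by positivity)
  set Q : Matrix (Fin n) (Fin m) ℝ := fun i j => HH S σ (Sum.inl i) (Sum.inr j) with hQ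
  set Y : Matrix (Fin n) (Fin m) ℝ := Matrix.diagonal (fun i => Real.sqrt (pr i)) * X *
    Matrix.diagonal (fun j => Real.sqrt (pc j)) with hY
  have hn0 : (0:ℝ) < n := by exact_mod_cast hn
  have hm0 : (0:ℝ) < m := by exact_mod_cast hm
  have hXY : ∀ i j, X i j = Real.sqrt n * Real.sqrt m * Y i j := by
    intro i j
    rw [hY, Matrix.mul_diagonal, Matrix.diagonal_mul, hr, hc, Real.sqrt_div zero_le_one,
      Real.sqrt_div zero_le_one, Real.sqrt_one]
    have := (Real.sqrt_pos.2 hn0).ne'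
    have := (Real.sqrt_pos.2 hm0).ne'
    field_simp
  have hop : ∀ v : Fin m → ℝ, ∑ i, (Q *ᵥ v) i ^ 2 ≤ B ^ 2 * ∑ j, v j ^ 2 := by
    intro v
    have := op_bound (HH S σ) (HH_herm S σ) k hk B hB hBk (Sum.elim (fun _ => 0) v)
    rw [Fintype.sum_sum_type, Fintype.sum_sum_type] at this
    simp only [Sum.elim_inl, Sum.elim_inr] at this
    have h3 : ∀ i, (HH S σ *ᵥ Sum.elim (fun _ => 0) v) (Sum.inl i) = (Q *ᵥ v) i := by
      intro i
      simp [Matrix.mulVec, dotProduct, Fintype.sum_sum_type, hQ]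
    simp only [h3] at this
    have h4 : 0 ≤ ∑ j, (HH S σ *ᵥ Sum.elim (fun _ => 0) v) (Sum.inr j) ^ 2 :=
      Finset.sum_nonneg fun _ _ => sq_nonneg _
    simp at this
    linarith
  have hd := dual_bound Q Y B hB hop
  have hsum : ∑ t, (if σ t then (1 : ℝ) else -1) * X (S t).1 (S t).2 = ∑ i, ∑ j, Q i j * X i j := by
    have hQe : ∀ i j, Q i j = ∑ t, (if σ t then (1 : ℝ) else -1) * (if (S t).1 = i ∧ (S t).2 = j then 1 else 0) := by
      intro i j
      simp only [hQ, HH, Matrix.sum_apply, Matrix.smul_apply, smul_eq_mul, eA, Matrix.add_apply,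
        Matrix.single_apply]
      simp
    simp only [hQe, Finset.sum_mul]
    rw [Finset.sum_congr rfl fun i _ => Finset.sum_comm, Finset.sum_comm]
    refine Finset.sum_congr rfl fun t _ => ?_
    simp [ite_and]
  rw [hsum]
  have hX' : traceNorm Y ≤ Real.sqrt r := hX
  calc ∑ i, ∑ j, Q i j * X i j = Real.sqrt n * Real.sqrt m * ∑ i, ∑ j, Q i j * Y i j := by
        simp only [Finset.mul_sum]
        refine Finset.sum_congr rfl fun i _ => Finset.sum_congr rfl fun j _ => by rw [hXY]; ring
    _ ≤ Real.sqrt n * Real.sqrt m * (B * Real.sqrt r) := by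
        refine mul_le_mul_of_nonneg_left (hd.trans (mul_le_mul_of_nonneg_left hX' hB)) (by positivity)
    _ = _ := by ring

theorem EE_pow {n m s : ℕ} {p : Matrix (Fin n) (Fin m) ℝ} (hp : IsDistrib p)
    (f : (Fin s → Fin n × Fin m) → (Fin s → Bool) → ℝ) (hf : ∀ S σ, 0 ≤ f S σ) (q : ℕ) :
    EE s p f ^ q ≤ EE s p (fun S σ => f S σ ^ q) := by
  have h1 := EE_const (s := s) hp 1
  unfold EE at *
  simp only [mul_one] at h1
  rw [← Fintype.sum_prod_type' (f := fun S σ => (sampleProb p S * (1 / 2 ^ s)) * f S σ),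
    ← Fintype.sum_prod_type' (f := fun S σ => (sampleProb p S * (1 / 2 ^ s)) * f S σ ^ q)]
  rw [← Fintype.sum_prod_type' (f := fun (S : Fin s → Fin n × Fin m) (σ : Fin s → Bool) =>
    (sampleProb p S * (1 / 2 ^ s)))] at h1
  exact Real.pow_arith_mean_le_arith_mean_pow univ
    (fun x : (Fin s → Fin n × Fin m) × (Fin s → Bool) => sampleProb p x.1 * (1 / 2 ^ s)) (fun x => f x.1 x.2)
    (fun x _ => mul_nonneg (sampleProb_nonneg hp _) (by positivity)) h1 (fun x _ => hf _ _) q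

theorem numeric (n m s k : ℕ) (hm : 2 ≤ m) (hmn : m ≤ n) (hs : (n : ℝ) * Real.log n ≤ s)
    (hk1 : Real.log n ≤ k) (hk2 : (k : ℝ) ≤ Real.log n + 1) (z : ℝ) (hz : z = m * Real.log n / s) :
    ((n : ℝ) + m) * (2 * k).factorial * (4 / z) ^ k * (1 + z / m) ^ s ≤
      (60 * Real.sqrt (s * Real.log n / m)) ^ (2 * k) := by
  have hn2 : (2:ℝ) ≤ n := by exact_mod_cast hm.trans hmn
  have hm2 : (2:ℝ) ≤ m := by exact_mod_cast hm
  have hmn' : (m:ℝ) ≤ n := by exact_mod_cast hmn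
  set L := Real.log n with hL
  have hLlo : 0.69 ≤ L := by
    have := Real.log_two_gt_d9
    have := Real.log_le_log (by norm_num) hn2
    linarith
  have hs0 : (0:ℝ) < s := lt_of_lt_of_le (by positivity) hs
  have hz0 : 0 < z := by rw [hz]; positivity
  have hexp : Real.exp L = n := Real.exp_log (by linarith)
  have h1 : (1 + z / m) ^ s ≤ (n : ℝ) := by
    have : (1 + z / m) ^ s ≤ Real.exp (z / m) ^ s := by
      refine pow_le_pow_left₀ (by positivity) ?_ s
      linarith [Real.add_one_le_exp (z / m)]
    rw [← Real.exp_nat_mul] at this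
    have e : (s : ℝ) * (z / m) = L := by rw [hz]; field_simp
    rwa [e, hexp] at this
  have h2 : ((n : ℝ) + m) * (1 + z / m) ^ s ≤ 27 ^ k := by
    have a : ((n : ℝ) + m) * (1 + z / m) ^ s ≤ (n * n) * n := by
      refine mul_le_mul (by nlinarith) h1 (by positivity) (by positivity)
    have b : ((n:ℝ) * n) * n = Real.exp L ^ 3 := by rw [hexp]; ring
    have c : Real.exp L ≤ 3 ^ k := by
      have : Real.exp L ≤ Real.exp k := Real.exp_le_exp.2 hk1
      refine this.trans ?_
      rw [← mul_one (k : ℝ), Real.exp_nat_mul]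
      exact pow_le_pow_left₀ (Real.exp_pos _).le (by linarith [Real.exp_one_lt_d9]) k
    have d : Real.exp L ^ 3 ≤ (3 ^ k) ^ 3 := pow_le_pow_left₀ (Real.exp_pos _).le c 3
    have e : ((3:ℝ) ^ k) ^ 3 = 27 ^ k := by rw [← pow_mul, mul_comm, pow_mul]; norm_num
    linarith
  have h3 : ((2 * k).factorial : ℝ) ≤ (4 * (k:ℝ) ^ 2) ^ k := by
    have : ((2 * k).factorial : ℝ) ≤ ((2 * k : ℕ) : ℝ) ^ (2 * k) := by exact_mod_cast Nat.factorial_le_pow (2 * k)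
    refine this.trans (le_of_eq ?_)
    rw [pow_mul]; push_cast; congr 1; ring
  calc ((n : ℝ) + m) * (2 * k).factorial * (4 / z) ^ k * (1 + z / m) ^ s
      = (((n : ℝ) + m) * (1 + z / m) ^ s) * (2 * k).factorial * (4 / z) ^ k := by ring
    _ ≤ 27 ^ k * (4 * (k:ℝ) ^ 2) ^ k * (4 / z) ^ k := by gcongr
    _ = (27 * (4 * (k:ℝ) ^ 2) * (4 / z)) ^ k := by rw [← mul_pow, ← mul_pow]
    _ ≤ (3600 * (s * L / m)) ^ k := by
        refine pow_le_pow_left₀ (by positivity) ?_ k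
        have e : 27 * (4 * (k:ℝ) ^ 2) * (4 / z) = (432 * k ^ 2 / L) * (s / m) := by
          rw [hz]; field_simp; ring
        have e' : 3600 * (s * L / m) = (3600 * L) * (s / m) := by ring
        rw [e, e']
        refine mul_le_mul_of_nonneg_right ?_ (by positivity)
        rw [div_le_iff₀ (by linarith)]
        have : (k:ℝ) ≤ 2.5 * L := by linarith
        have hk0 : (0:ℝ) ≤ k := by positivity
        nlinarith
    _ = _ := by
        rw [pow_mul, mul_pow 60, Real.sq_sqrt (by positivity)]; norm_num
/-- for a sampling distribution with uniform row- and column-marginals and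
`s ≥ n log n`, the expected empirical Rademacher complexity of the `p`-weighted trace-norm
ball is at most `C·√(r n log n / s)`. -/
theorem expected_rademacher_uniform_marginals :
    ∃ C : ℝ, 0 < C ∧
      ∀ (n m s : ℕ) (r : ℝ) (p : Matrix (Fin n) (Fin m) ℝ),
        2 ≤ m → m ≤ n → 1 ≤ r →
        IsDistrib p →
        (∀ i, rowMarg p i = 1 / (n : ℝ)) →
        (∀ j, colMarg p j = 1 / (m : ℝ)) →
        (n : ℝ) * Real.log n ≤ (s : ℝ) →
        Esample s p (fun S => rademacher S (Wball (rowMarg p) (colMarg p) r)) ≤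
          C * Real.sqrt (r * n * Real.log n / s) := by
  refine ⟨60, by norm_num, ?_⟩
  intro n m s r p hm hmn hr1 hp hr hc hs
  have hn2 : (2:ℝ) ≤ n := by exact_mod_cast hm.trans hmn
  have hm2 : (2:ℝ) ≤ m := by exact_mod_cast hm
  have hmn' : (m:ℝ) ≤ n := by exact_mod_cast hmn
  have hL0 : 0 < Real.log n := Real.log_pos (by linarith)
  have hs0 : (0:ℝ) < s := lt_of_lt_of_le (by positivity) hs
  set k := ⌈Real.log n⌉₊ with hkdef
  have hk1 : Real.log n ≤ k := Nat.le_ceil _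
  have hk2 : (k:ℝ) ≤ Real.log n + 1 := (Nat.ceil_lt_add_one hL0.le).le
  have hk : 1 ≤ k := Nat.ceil_pos.2 hL0
  set z : ℝ := m * Real.log n / s with hz
  have hz0 : 0 < z := by positivity
  have hz1 : z ≤ 1 := by
    rw [hz, div_le_one hs0]
    exact (mul_le_mul_of_nonneg_right hmn' hL0.le).trans hs
  have hmom := (moment hp (by omega) hmn hr hc z hz0 hz1 s k).trans
    (numeric n m s k hm hmn hs hk1 hk2 z hz)
  have htr : ∀ (S : Fin s → Fin n × Fin m) (σ : Fin s → Bool), 0 ≤ (HH S σ ^ (2 * k)).trace := fun S σ =>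
    Finset.sum_nonneg fun x _ => diag_nonneg _ (HH_herm S σ) _ (even_two_mul k) x
  set B : (Fin s → Fin n × Fin m) → (Fin s → Bool) → ℝ :=
    fun S σ => ((HH S σ ^ (2 * k)).trace) ^ (((2 * k : ℕ) : ℝ)⁻¹) with hBdef
  have hB0 : ∀ S σ, 0 ≤ B S σ := fun S σ => Real.rpow_nonneg (htr S σ) _
  have hBk : ∀ S σ, B S σ ^ (2 * k) = (HH S σ ^ (2 * k)).trace := fun S σ =>
    Real.rpow_inv_natCast_pow (htr S σ) (by omega)
  have hEB : EE s p B ≤ 60 * Real.sqrt (s * Real.log n / m) := by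
    have h1 := EE_pow hp B hB0 (2 * k)
    simp only [hBk] at h1
    exact le_of_pow_le_pow_left₀ (by omega) (by positivity) (h1.trans hmom)
  set c : ℝ := (1 / (s : ℝ)) * (Real.sqrt n * Real.sqrt m * Real.sqrt r) with hcdef
  have hmain : Esample s p (fun S => rademacher S (Wball (rowMarg p) (colMarg p) r)) ≤ c * EE s p B := by
    rw [← EE_mul]
    unfold Esample EE rademacher
    refine Finset.sum_le_sum fun S _ => ?_
    rw [← mul_assoc, Finset.mul_sum]
    refine Finset.sum_le_sum fun σ _ => ?_
    refine mul_le_mul_of_nonneg_left ?_ (mul_nonneg (sampleProb_nonneg hp S) (by positivity))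
    exact sup_bound (by omega) (by omega) r _ _ hr hc S σ k hk (B S σ) (hB0 S σ) (hBk S σ).ge
  refine hmain.trans ((mul_le_mul_of_nonneg_left hEB (by positivity)).trans (le_of_eq ?_))
  have e1 : r * n * Real.log n / s = (1 / s) ^ 2 * (n * m * r * (s * Real.log n / m)) := by
    field_simp
  rw [e1, Real.sqrt_mul (by positivity), Real.sqrt_sq (by positivity), Real.sqrt_mul (by positivity),
    Real.sqrt_mul (by positivity), Real.sqrt_mul (by positivity), hcdef]
  ring

end
end
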